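/- arXiv:1710.00647 — 3 statements merged into one kernel-verified Lean document; each statement's English description precedes it below -/
import Mathlib

section
/- For every k ≥ 26 with k ≡ 2 (mod 24), there exists an almost resolvable k-cycle system of order 2k+1. -/
/-- The set of edges of the closed walk `c 0, c 1, …, c (k-1), c 0`.
When `c` is injective, this is a cycle of length `k`. -/
def cycleEdgeSet {V : Type*} {k : ℕ} (c : ZMod k → V) : Set (Sym2 V) :=
  {e | ∃ i : ZMod k, e = s(c i, c (i + 1))}

/-- `HasARCS k v` asserts the existence of an almost resolvable `k`-cycle system of
order `v`: a collection of `k`-cycles whose edge sets partition the edge set of the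
complete graph on `v` vertices, partitioned into `(v-1)/2` almost parallel classes
(each consisting of `(v-1)/k` pairwise vertex-disjoint `k`-cycles) together with one
half-parallel class (consisting of `(v-1)/(2k)` pairwise vertex-disjoint `k`-cycles). -/
def HasARCS (k v : ℕ) : Prop :=
  ∃ (apc : Fin ((v - 1) / 2) → Fin ((v - 1) / k) → ZMod k → Fin v)
    (hpc : Fin ((v - 1) / (2 * k)) → ZMod k → Fin v),
    (∀ i j, Function.Injective (apc i j)) ∧
    (∀ j, Function.Injective (hpc j)) ∧
    (∀ i, ∀ j₁ j₂, j₁ ≠ j₂ →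
      Disjoint (Set.range (apc i j₁)) (Set.range (apc i j₂))) ∧
    (∀ j₁ j₂, j₁ ≠ j₂ → Disjoint (Set.range (hpc j₁)) (Set.range (hpc j₂))) ∧
    (∀ e : Sym2 (Fin v), ¬ e.IsDiag →
      ∃! p : (Fin ((v - 1) / 2) × Fin ((v - 1) / k)) ⊕ Fin ((v - 1) / (2 * k)),
        e ∈ Sum.elim (fun q => cycleEdgeSet (apc q.1 q.2))
              (fun j => cycleEdgeSet (hpc j)) p)


/-- Abstract criterion: covering all vertices and all edges is enough, by counting. -/
theorem hasARCS_of_cover (k : ℕ) (hk : 0 < k) {V I : Type} [Fintype V] [DecidableEq V]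
    [Fintype I] (hV : Fintype.card V = 2 * k + 1) (hI : Fintype.card I = k)
    (w : I → Fin 2 → ZMod k → V) (h : ZMod k → V) (hinj : Function.Injective h)
    (miss : I → V)
    (H1 : ∀ i u, u ≠ miss i → ∃ j p, w i j p = u)
    (H2 : ∀ u u', u ≠ u' → (∃ i j p, s(u, u') = s(w i j p, w i j (p + 1))) ∨
      ∃ p, s(u, u') = s(h p, h (p + 1))) :
    HasARCS k (2 * k + 1) := by
  classical
  have : NeZero k := ⟨hk.ne'⟩
  have hw : ∀ i, Function.Injective (fun x : Fin 2 × ZMod k => w i x.1 x.2) := by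
    intro i
    have hsub : (Finset.univ.erase (miss i)) ⊆
        Finset.univ.image (fun x : Fin 2 × ZMod k => w i x.1 x.2) := by
      intro u hu
      obtain ⟨j, p, hp⟩ := H1 i u (Finset.ne_of_mem_erase hu)
      exact Finset.mem_image.2 ⟨(j, p), Finset.mem_univ _, hp⟩
    have hc := Finset.card_le_card hsub
    rw [Finset.card_erase_of_mem (Finset.mem_univ _), Finset.card_univ, hV] at hc
    have hcard : (Finset.univ : Finset (Fin 2 × ZMod k)).card = 2 * k := by
      simp [ZMod.card]
    have := Finset.card_image_iff.1
      (le_antisymm Finset.card_image_le (by rw [hcard]; simpa using hc))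
    intro x y hxy
    exact this (by simp) (by simp) hxy
  let F : (I × Fin 2 × ZMod k) ⊕ ZMod k → Sym2 V :=
    Sum.elim (fun x => s(w x.1 x.2.1 x.2.2, w x.1 x.2.1 (x.2.2 + 1)))
      (fun p => s(h p, h (p + 1)))
  have hF : Function.Injective F := by
    have hsub : (Finset.univ.filter (fun e : Sym2 V => ¬ e.IsDiag)) ⊆
        Finset.univ.image F := by
      intro e he
      induction e using Sym2.ind with
      | _ u u' =>
        have hne : u ≠ u' := by simpa using he
        rcases H2 u u' hne with ⟨i, j, p, hp⟩ | ⟨p, hp⟩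
        · exact Finset.mem_image.2 ⟨Sum.inl (i, j, p), Finset.mem_univ _, hp.symm⟩
        · exact Finset.mem_image.2 ⟨Sum.inr p, Finset.mem_univ _, hp.symm⟩
    have hc := Finset.card_le_card hsub
    rw [← Fintype.card_subtype, Sym2.card_subtype_not_diag, hV] at hc
    have hcard : (Finset.univ : Finset ((I × Fin 2 × ZMod k) ⊕ ZMod k)).card
        = (2 * k + 1).choose 2 := by
      simp only [Finset.card_univ, Fintype.card_sum, Fintype.card_prod, hI, Fintype.card_fin,
        ZMod.card, Nat.choose_two_right]
      symm
      apply Nat.div_eq_of_eq_mul_right (by norm_num)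
      simp only [Nat.add_sub_cancel]
      ring
    have := Finset.card_image_iff.1
      (le_antisymm Finset.card_image_le (by rw [hcard]; exact hc))
    intro x y hxy
    exact this (by simp) (by simp) hxy
  have e1 : Fin ((2 * k + 1 - 1) / 2) ≃ I := Fintype.equivOfCardEq (by simp [hI])
  have e2 : Fin ((2 * k + 1 - 1) / k) ≃ Fin 2 := Fintype.equivOfCardEq (by
    simp [Nat.mul_div_cancel _ hk])
  have h3 : (2 * k + 1 - 1) / (2 * k) = 1 := by
    rw [Nat.add_sub_cancel]; exact Nat.div_self (by omega)
  have e4 : V ≃ Fin (2 * k + 1) := Fintype.equivOfCardEq (by simp [hV])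
  have hsubs : ∀ a b : Fin ((2 * k + 1 - 1) / (2 * k)), a = b := by
    rw [h3]; exact fun a b => Subsingleton.elim a b
  have z3 : Fin ((2 * k + 1 - 1) / (2 * k)) := ⟨0, by rw [h3]; norm_num⟩
  have hmap : ∀ a b c d : V, s(e4 a, e4 b) = s(e4 c, e4 d) ↔ s(a, b) = s(c, d) := by
    intro a b c d
    simp
  refine ⟨fun i j p => e4 (w (e1 i) (e2 j) p), fun _ p => e4 (h p), ?_, ?_, ?_, ?_, ?_⟩
  · intro i j p p' hp
    have := hw (e1 i) (a₁ := (e2 j, p)) (a₂ := (e2 j, p')) (e4.injective hp)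
    exact (Prod.ext_iff.1 this).2
  · intro _ p p' hp
    exact hinj (e4.injective hp)
  · intro i j₁ j₂ hj
    rw [Set.disjoint_left]
    rintro _ ⟨p, rfl⟩ ⟨p', hp⟩
    have := hw (e1 i) (a₁ := (e2 j₂, p')) (a₂ := (e2 j₁, p)) (e4.injective hp)
    exact hj (e2.injective (Prod.ext_iff.1 this).1.symm)
  · intro j₁ j₂ hj
    exact absurd (hsubs j₁ j₂) hj
  · intro e he
    induction e using Sym2.ind with
    | _ a b =>
      obtain ⟨u, rfl⟩ := e4.surjective a
      obtain ⟨u', rfl⟩ := e4.surjective b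
      have hne : u ≠ u' := fun hh => he (by simp [hh])
      have key : ∃ x, s(u, u') = F x := by
        rcases H2 u u' hne with ⟨i, j, p, hp⟩ | ⟨p, hp⟩
        · exact ⟨Sum.inl (i, j, p), hp⟩
        · exact ⟨Sum.inr p, hp⟩
      obtain ⟨x, hx⟩ := key
      have uniq : ∀ y, s(u, u') = F y → y = x := fun y hy => hF (hy.symm.trans hx)
      rcases x with ⟨i, j, p⟩ | p
      · refine ⟨Sum.inl (e1.symm i, e2.symm j), ⟨p, ?_⟩, ?_⟩
        · simpa [F] using hx
        · rintro (⟨i', j'⟩ | j') ⟨p', hp'⟩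
          · have := uniq (Sum.inl (e1 i', e2 j', p')) ((hmap _ _ _ _).1 hp')
            simp only [Sum.inl.injEq, Prod.mk.injEq] at this
            rw [← this.1, ← this.2.1]
            simp
          · have := uniq (Sum.inr p') ((hmap _ _ _ _).1 hp')
            simp at this
      · refine ⟨Sum.inr z3, ⟨p, ?_⟩, ?_⟩
        · simpa [F] using hx
        · rintro (⟨i', j'⟩ | j') ⟨p', hp'⟩
          · have := uniq (Sum.inl (e1 i', e2 j', p')) ((hmap _ _ _ _).1 hp')
            simp at this
          · rw [hsubs j' z3]

/-- The vertices: four copies of the cyclic group of order `4 q + 1`, and a point at infinity. -/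
abbrev ArcV (q : ℕ) : Type := Option (Fin 4 × ZMod (4 * q + 1))

/-- The vertex with value `x` on level `l`. -/
def apt (q : ℕ) (l : Fin 4) (x : ℤ) : ArcV q := some (l, (x : ZMod (4 * q + 1)))

/-- The zigzag `a, b, a + δ, b - δ, a + 2 δ, ...` with alternating levels `i` and `j`. -/
def azig (q : ℕ) (i j : Fin 4) (a b δ : ℤ) (p : ℕ) : ArcV q :=
  if p % 2 = 0 then apt q i (a + δ * (p / 2 : ℕ)) else apt q j (b - δ * (p / 2 : ℕ))

/-- First cycle of the first base class. -/
def arcA (q p : ℕ) : ArcV q :=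
  if p < 4 * q - 2 then azig q 0 1 1 (2 * q - 1) 1 p
  else if p < 4 * q - 1 then apt q 0 (2 * q)
  else if p < 4 * q then none
  else if p < 4 * q + 1 then apt q 1 (4 * q)
  else if p < 6 * q + 2 then azig q 0 0 (2 * q + 1) (4 * q + 1) 1 (p - (4 * q + 1))
  else if p < 8 * q + 1 then azig q 2 2 (3 * q) (3 * q + 1) (-1) (p - (6 * q + 2))
  else apt q 2 (4 * q)

/-- Second cycle of the first base class. -/
def arcB (q p : ℕ) : ArcV q :=
  if p < 4 * q then azig q 2 3 (2 * q) 1 (-1) p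
  else if p < 4 * q + 1 then apt q 2 0
  else if p < 6 * q + 1 then azig q 1 1 (3 * q) (3 * q - 1) 1 (p - (4 * q + 1))
  else if p < 6 * q + 2 then apt q 3 (3 * q + 1)
  else if p < 8 * q + 1 then azig q 3 3 (3 * q) (3 * q + 2) (-1) (p - (6 * q + 2))
  else apt q 3 0

/-- First cycle of the second base class. -/
def arcC (q p : ℕ) : ArcV q :=
  if p < 4 * q then azig q 2 0 (4 * q - 1) 1 (-1) p
  else if p < 4 * q + 1 then apt q 3 (2 * q)
  else if p < 8 * q + 1 then azig q 0 3 (2 * q + 1) (2 * q - 1) 1 (p - (4 * q + 1))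
  else apt q 1 (3 * q - 1)

/-- Second cycle of the second base class. -/
def arcD (q p : ℕ) : ArcV q :=
  if p < 4 * q then azig q 3 1 (2 * q + 1) (q - 2) 1 p
  else if p < 8 * q then azig q 1 2 (q - 1) (2 * q - 2) 1 (p - 4 * q)
  else if p < 8 * q + 1 then apt q 2 (2 * q - 1)
  else none

/-- The two base classes. -/
def arcW (q : ℕ) (c j : Fin 2) : ℕ → ArcV q :=
  if c = 0 then (if j = 0 then arcA q else arcB q) else (if j = 0 then arcC q else arcD q)

/-- Vertex `u` is visited by base class `c`. -/
def AVis (q : ℕ) (c : Fin 2) (u : ArcV q) : Prop :=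
  ∃ j : Fin 2, ∃ p, p < 8 * q + 2 ∧ arcW q c j p = u

/-- The pair is an edge of one of the base cycles. -/
def AEdg (q : ℕ) (u u' : ArcV q) : Prop :=
  ∃ c j : Fin 2, ∃ p, p < 8 * q + 2 ∧
    s(u, u') = s(arcW q c j p, arcW q c j ((p + 1) % (8 * q + 2)))

/-- Some base edge joins level `i` to level `j` with difference `d`. -/
def ADif (q : ℕ) (i j : Fin 4) (d : ℤ) : Prop :=
  ∃ x : ℤ, AEdg q (apt q i x) (apt q j (x + d))

theorem apt_sub (q : ℕ) (l : Fin 4) (x : ℤ) : apt q l (x - (4 * q + 1)) = apt q l x := by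
  have : ((4 * q + 1 : ℕ) : ZMod (4 * q + 1)) = 0 := ZMod.natCast_self _
  push_cast at this
  simp [apt, this]

theorem apt_add (q : ℕ) (l : Fin 4) (x : ℤ) : apt q l (x + (4 * q + 1)) = apt q l x := by
  rw [← apt_sub q l (x + _)]; congr 1; ring

theorem AEdg.symm {q : ℕ} {u u' : ArcV q} (h : AEdg q u u') : AEdg q u' u := by
  obtain ⟨c, j, p, hp, h⟩ := h
  exact ⟨c, j, p, hp, by rw [← h, Sym2.eq_swap]⟩

theorem ADif.of_edge {q : ℕ} {i j : Fin 4} {x y : ℤ} (h : AEdg q (apt q i x) (apt q j y))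
    (d : ℤ) (hd : d = y - x) : ADif q i j d :=
  ⟨x, by rw [hd]; simpa using h⟩

theorem ADif.symm {q : ℕ} {i j : Fin 4} {d : ℤ} (h : ADif q i j d) (d' : ℤ) (hd : d' = -d) :
    ADif q j i d' := by
  obtain ⟨x, h⟩ := h
  exact ⟨x + d, by rw [hd]; simpa using h.symm⟩

theorem ADif.shift {q : ℕ} {i j : Fin 4} {d : ℤ} (h : ADif q i j d) (d' : ℤ)
    (hd : d' = d + (4 * q + 1)) : ADif q i j d' := by
  obtain ⟨x, h⟩ := h
  exact ⟨x, by rw [hd, ← add_assoc, apt_add]; exact h⟩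

theorem AVis.shift {q : ℕ} {c : Fin 2} {l : Fin 4} {x : ℤ} (h : AVis q c (apt q l x)) (y : ℤ)
    (hy : y = x + (4 * q + 1)) : AVis q c (apt q l y) := by
  rw [hy, apt_add]; exact h

theorem AVis.unshift {q : ℕ} {c : Fin 2} {l : Fin 4} {x : ℤ} (h : AVis q c (apt q l x)) (y : ℤ)
    (hy : y = x - (4 * q + 1)) : AVis q c (apt q l y) := by
  rw [hy, apt_sub]; exact h

section zig
variable {q : ℕ} {c jj : Fin 2} {s L : ℕ} {i j : Fin 4} {a b δ : ℤ}

theorem zig_even (hs : s + L ≤ 8 * q + 2)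
    (hz : ∀ p, p < L → arcW q c jj (s + p) = azig q i j a b δ p)
    (y e : ℤ) (he : 0 ≤ e) (heL : 2 * e < L) (hy : y = a + δ * e) : AVis q c (apt q i y) := by
  lift e to ℕ using he
  refine ⟨jj, s + 2 * e, by omega, ?_⟩
  rw [hz _ (by omega), azig, if_pos (by omega), hy, Nat.mul_div_cancel_left _ (by norm_num)]

theorem zig_odd (hs : s + L ≤ 8 * q + 2)
    (hz : ∀ p, p < L → arcW q c jj (s + p) = azig q i j a b δ p)
    (y e : ℤ) (he : 0 ≤ e) (heL : 2 * e + 1 < L) (hy : y = b - δ * e) :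
    AVis q c (apt q j y) := by
  lift e to ℕ using he
  refine ⟨jj, s + (2 * e + 1), by omega, ?_⟩
  rw [hz _ (by omega), azig, if_neg (by omega), hy, show (2 * e + 1) / 2 = e by omega]

theorem zig_dif (hs : s + L ≤ 8 * q + 2)
    (hz : ∀ p, p < L → arcW q c jj (s + p) = azig q i j a b δ p)
    (d e : ℤ) (he : 0 ≤ e) (heL : e + 1 < L) (hd : d = b - a - δ * e) : ADif q i j d := by
  lift e to ℕ using he
  have h1 := hz e (by omega)
  have h2 := hz (e + 1) (by omega)
  have hE : AEdg q (azig q i j a b δ e) (azig q i j a b δ (e + 1)) := by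
    refine ⟨c, jj, s + e, by omega, ?_⟩
    rw [Nat.mod_eq_of_lt (by omega), h1, add_assoc, h2]
  rcases Nat.even_or_odd' e with ⟨m, rfl | rfl⟩
  · rw [azig, azig, if_pos (by omega), if_neg (by omega), show 2 * m / 2 = m by omega,
      show (2 * m + 1) / 2 = m by omega] at hE
    exact ADif.of_edge hE d (by rw [hd]; push_cast; ring)
  · rw [azig, azig, if_neg (by omega), if_pos (by omega), show (2 * m + 1) / 2 = m by omega,
      show (2 * m + 1 + 1) / 2 = m + 1 by omega] at hE
    exact ADif.of_edge hE.symm d (by rw [hd]; push_cast; ring)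

end zig

set_option linter.unusedVariables false
set_option linter.unusedSimpArgs false

section segments
variable {q : ℕ}

theorem arcW_eqA (q : ℕ) : arcW q 0 0 = arcA q := by simp [arcW]
theorem arcW_eqB (q : ℕ) : arcW q 0 1 = arcB q := by simp [arcW]
theorem arcW_eqC (q : ℕ) : arcW q 1 0 = arcC q := by simp [arcW]
theorem arcW_eqD (q : ℕ) : arcW q 1 1 = arcD q := by simp [arcW]

theorem segA1 (hq : 1 ≤ q) (p : ℕ) (hp : p < 4 * q - 2) :
    arcW q 0 0 (0 + p) = azig q 0 1 1 (2 * q - 1) 1 p := by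
  rw [arcW_eqA, arcA]
  simp (disch := omega) only [if_pos, if_neg, Nat.add_sub_cancel_left, zero_add]

theorem segA2 (hq : 1 ≤ q) (p : ℕ) (hp : p < 2 * q + 1) :
    arcW q 0 0 (4 * q + 1 + p) = azig q 0 0 (2 * q + 1) (4 * q + 1) 1 p := by
  rw [arcW_eqA, arcA]
  simp (disch := omega) only [if_pos, if_neg, Nat.add_sub_cancel_left, zero_add]

theorem segA3 (hq : 1 ≤ q) (p : ℕ) (hp : p < 2 * q - 1) :
    arcW q 0 0 (6 * q + 2 + p) = azig q 2 2 (3 * q) (3 * q + 1) (-1) p := by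
  rw [arcW_eqA, arcA]
  simp (disch := omega) only [if_pos, if_neg, Nat.add_sub_cancel_left, zero_add]

theorem segB1 (hq : 1 ≤ q) (p : ℕ) (hp : p < 4 * q) :
    arcW q 0 1 (0 + p) = azig q 2 3 (2 * q) 1 (-1) p := by
  rw [arcW_eqB, arcB]
  simp (disch := omega) only [if_pos, if_neg, Nat.add_sub_cancel_left, zero_add]

theorem segB2 (hq : 1 ≤ q) (p : ℕ) (hp : p < 2 * q) :
    arcW q 0 1 (4 * q + 1 + p) = azig q 1 1 (3 * q) (3 * q - 1) 1 p := by
  rw [arcW_eqB, arcB]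
  simp (disch := omega) only [if_pos, if_neg, Nat.add_sub_cancel_left, zero_add]

theorem segB3 (hq : 1 ≤ q) (p : ℕ) (hp : p < 2 * q - 1) :
    arcW q 0 1 (6 * q + 2 + p) = azig q 3 3 (3 * q) (3 * q + 2) (-1) p := by
  rw [arcW_eqB, arcB]
  simp (disch := omega) only [if_pos, if_neg, Nat.add_sub_cancel_left, zero_add]

theorem segC1 (hq : 1 ≤ q) (p : ℕ) (hp : p < 4 * q) :
    arcW q 1 0 (0 + p) = azig q 2 0 (4 * q - 1) 1 (-1) p := by
  rw [arcW_eqC, arcC]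
  simp (disch := omega) only [if_pos, if_neg, Nat.add_sub_cancel_left, zero_add]

theorem segC2 (hq : 1 ≤ q) (p : ℕ) (hp : p < 4 * q) :
    arcW q 1 0 (4 * q + 1 + p) = azig q 0 3 (2 * q + 1) (2 * q - 1) 1 p := by
  rw [arcW_eqC, arcC]
  simp (disch := omega) only [if_pos, if_neg, Nat.add_sub_cancel_left, zero_add]

theorem segD1 (hq : 1 ≤ q) (p : ℕ) (hp : p < 4 * q) :
    arcW q 1 1 (0 + p) = azig q 3 1 (2 * q + 1) (q - 2) 1 p := by
  rw [arcW_eqD, arcD]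
  simp (disch := omega) only [if_pos, if_neg, Nat.add_sub_cancel_left, zero_add]

theorem segD2 (hq : 1 ≤ q) (p : ℕ) (hp : p < 4 * q) :
    arcW q 1 1 (4 * q + p) = azig q 1 2 (q - 1) (2 * q - 2) 1 p := by
  rw [arcW_eqD, arcD]
  simp (disch := omega) only [if_pos, if_neg, Nat.add_sub_cancel_left, zero_add]

theorem ptA4 (hq : 1 ≤ q) : arcW q 0 0 (4 * q - 2) = apt q 0 (2 * q) := by
  rw [arcW_eqA, arcA]
  simp (disch := omega) only [if_pos, if_neg]

theorem ptA5 (hq : 1 ≤ q) : arcW q 0 0 (4 * q - 1) = none := by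
  rw [arcW_eqA, arcA]
  simp (disch := omega) only [if_pos, if_neg]

theorem ptA6 (hq : 1 ≤ q) : arcW q 0 0 (4 * q) = apt q 1 (4 * q) := by
  rw [arcW_eqA, arcA]
  simp (disch := omega) only [if_pos, if_neg]

theorem ptA7 (hq : 1 ≤ q) : arcW q 0 0 (8 * q + 1) = apt q 2 (4 * q) := by
  rw [arcW_eqA, arcA]
  simp (disch := omega) only [if_pos, if_neg]

theorem ptB4 (hq : 1 ≤ q) : arcW q 0 1 (4 * q) = apt q 2 0 := by
  rw [arcW_eqB, arcB]
  simp (disch := omega) only [if_pos, if_neg]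

theorem ptB5 (hq : 1 ≤ q) : arcW q 0 1 (6 * q + 1) = apt q 3 (3 * q + 1) := by
  rw [arcW_eqB, arcB]
  simp (disch := omega) only [if_pos, if_neg]

theorem ptB6 (hq : 1 ≤ q) : arcW q 0 1 (8 * q + 1) = apt q 3 0 := by
  rw [arcW_eqB, arcB]
  simp (disch := omega) only [if_pos, if_neg]

theorem ptC3 (hq : 1 ≤ q) : arcW q 1 0 (4 * q) = apt q 3 (2 * q) := by
  rw [arcW_eqC, arcC]
  simp (disch := omega) only [if_pos, if_neg]

theorem ptC4 (hq : 1 ≤ q) : arcW q 1 0 (8 * q + 1) = apt q 1 (3 * q - 1) := by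
  rw [arcW_eqC, arcC]
  simp (disch := omega) only [if_pos, if_neg]

theorem ptD3 (hq : 1 ≤ q) : arcW q 1 1 (8 * q) = apt q 2 (2 * q - 1) := by
  rw [arcW_eqD, arcD]
  simp (disch := omega) only [if_pos, if_neg]

theorem ptD4 (hq : 1 ≤ q) : arcW q 1 1 (8 * q + 1) = none := by
  rw [arcW_eqD, arcD]
  simp (disch := omega) only [if_pos, if_neg]

theorem ptA8 (hq : 1 ≤ q) : arcW q 0 0 (0) = apt q 0 1 := by
  rw [arcW_eqA, arcA]
  simp (disch := omega) only [if_pos, if_neg, azig]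
  exact congrArg (apt q _) (by omega)

theorem ptA9 (hq : 1 ≤ q) : arcW q 0 0 (4 * q - 3) = apt q 1 1 := by
  rw [arcW_eqA, arcA]
  simp (disch := omega) only [if_pos, if_neg, azig]
  exact congrArg (apt q _) (by omega)

theorem ptA10 (hq : 1 ≤ q) : arcW q 0 0 (4 * q + 1) = apt q 0 (2 * q + 1) := by
  rw [arcW_eqA, arcA]
  simp (disch := omega) only [if_pos, if_neg, azig]
  exact congrArg (apt q _) (by omega)

theorem ptA11 (hq : 1 ≤ q) : arcW q 0 0 (6 * q + 1) = apt q 0 (3 * q + 1) := by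
  rw [arcW_eqA, arcA]
  simp (disch := omega) only [if_pos, if_neg, azig]
  exact congrArg (apt q _) (by omega)

theorem ptA12 (hq : 1 ≤ q) : arcW q 0 0 (6 * q + 2) = apt q 2 (3 * q) := by
  rw [arcW_eqA, arcA]
  simp (disch := omega) only [if_pos, if_neg, azig]
  exact congrArg (apt q _) (by omega)

theorem ptA13 (hq : 1 ≤ q) : arcW q 0 0 (8 * q) = apt q 2 (2 * q + 1) := by
  rw [arcW_eqA, arcA]
  simp (disch := omega) only [if_pos, if_neg, azig]
  exact congrArg (apt q _) (by omega)

theorem ptB7 (hq : 1 ≤ q) : arcW q 0 1 (0) = apt q 2 (2 * q) := by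
  rw [arcW_eqB, arcB]
  simp (disch := omega) only [if_pos, if_neg, azig]
  exact congrArg (apt q _) (by omega)

theorem ptB8 (hq : 1 ≤ q) : arcW q 0 1 (4 * q - 1) = apt q 3 (2 * q) := by
  rw [arcW_eqB, arcB]
  simp (disch := omega) only [if_pos, if_neg, azig]
  exact congrArg (apt q _) (by omega)

theorem ptB9 (hq : 1 ≤ q) : arcW q 0 1 (4 * q + 1) = apt q 1 (3 * q) := by
  rw [arcW_eqB, arcB]
  simp (disch := omega) only [if_pos, if_neg, azig]
  exact congrArg (apt q _) (by omega)

theorem ptB10 (hq : 1 ≤ q) : arcW q 0 1 (6 * q) = apt q 1 (2 * q) := by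
  rw [arcW_eqB, arcB]
  simp (disch := omega) only [if_pos, if_neg, azig]
  exact congrArg (apt q _) (by omega)

theorem ptB11 (hq : 1 ≤ q) : arcW q 0 1 (6 * q + 2) = apt q 3 (3 * q) := by
  rw [arcW_eqB, arcB]
  simp (disch := omega) only [if_pos, if_neg, azig]
  exact congrArg (apt q _) (by omega)

theorem ptB12 (hq : 1 ≤ q) : arcW q 0 1 (8 * q) = apt q 3 (2 * q + 1) := by
  rw [arcW_eqB, arcB]
  simp (disch := omega) only [if_pos, if_neg, azig]
  exact congrArg (apt q _) (by omega)

theorem ptC5 (hq : 1 ≤ q) : arcW q 1 0 (0) = apt q 2 (4 * q - 1) := by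
  rw [arcW_eqC, arcC]
  simp (disch := omega) only [if_pos, if_neg, azig]
  exact congrArg (apt q _) (by omega)

theorem ptC6 (hq : 1 ≤ q) : arcW q 1 0 (4 * q - 1) = apt q 0 (2 * q) := by
  rw [arcW_eqC, arcC]
  simp (disch := omega) only [if_pos, if_neg, azig]
  exact congrArg (apt q _) (by omega)

theorem ptC7 (hq : 1 ≤ q) : arcW q 1 0 (4 * q + 1) = apt q 0 (2 * q + 1) := by
  rw [arcW_eqC, arcC]
  simp (disch := omega) only [if_pos, if_neg, azig]
  exact congrArg (apt q _) (by omega)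

theorem ptC8 (hq : 1 ≤ q) : arcW q 1 0 (8 * q) = apt q 3 0 := by
  rw [arcW_eqC, arcC]
  simp (disch := omega) only [if_pos, if_neg, azig]
  exact congrArg (apt q _) (by omega)

theorem ptD5 (hq : 1 ≤ q) : arcW q 1 1 (0) = apt q 3 (2 * q + 1) := by
  rw [arcW_eqD, arcD]
  simp (disch := omega) only [if_pos, if_neg, azig]
  exact congrArg (apt q _) (by omega)

theorem ptD6 (hq : 1 ≤ q) : arcW q 1 1 (4 * q - 1) = apt q 1 (-q - 1) := by
  rw [arcW_eqD, arcD]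
  simp (disch := omega) only [if_pos, if_neg, azig]
  exact congrArg (apt q _) (by omega)

theorem ptD7 (hq : 1 ≤ q) : arcW q 1 1 (4 * q) = apt q 1 (q - 1) := by
  rw [arcW_eqD, arcD]
  simp (disch := omega) only [if_pos, if_neg, azig]
  exact congrArg (apt q _) (by omega)

theorem ptD8 (hq : 1 ≤ q) : arcW q 1 1 (8 * q - 1) = apt q 2 (-1) := by
  rw [arcW_eqD, arcD]
  simp (disch := omega) only [if_pos, if_neg, azig]
  exact congrArg (apt q _) (by omega)

theorem link {c j : Fin 2} {u u' : ArcV q} (p p' : ℕ) (hp : p' = p + 1) (hk : p' < 8 * q + 2)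
    (h : arcW q c j p = u) (h' : arcW q c j p' = u') : AEdg q u u' :=
  ⟨c, j, p, by omega, by rw [← hp, Nat.mod_eq_of_lt hk, h, h']⟩

theorem wrap {c j : Fin 2} {u u' : ArcV q}
    (h : arcW q c j (8 * q + 1) = u) (h' : arcW q c j 0 = u') : AEdg q u u' :=
  ⟨c, j, 8 * q + 1, by omega, by rw [h, Nat.mod_self, h']⟩

theorem pt_vis {c j : Fin 2} {u : ArcV q} {p : ℕ} (h : arcW q c j p = u)
    (hk : p < 8 * q + 2) : AVis q c u := ⟨j, p, hk, h⟩

theorem vis00 (hq : 1 ≤ q) (y : ℤ) (h0 : 0 ≤ y) (h1 : y ≤ 4 * q) : AVis q 0 (apt q 0 y) := by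
  by_cases hc0 : y = 0
  · exact (zig_odd (by omega) (segA2 hq) (y + (4 * q + 1)) (-y) (by omega) (by omega) (by omega)).unshift y (by omega)
  by_cases hc1 : y ≤ 2 * q - 1
  · exact zig_even (by omega) (segA1 hq) y (y - 1) (by omega) (by omega) (by omega)
  by_cases hc2 : y = 2 * q
  · exact by have := pt_vis (ptA4 hq) (by omega); rwa [show y = 2 * q by omega]
  by_cases hc3 : y ≤ 3 * q + 1
  · exact zig_even (by omega) (segA2 hq) y (y - (2 * q + 1)) (by omega) (by omega) (by omega)
  exact zig_odd (by omega) (segA2 hq) y (4 * q + 1 - y) (by omega) (by omega) (by omega)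

theorem vis01 (hq : 1 ≤ q) (y : ℤ) (h0 : 1 ≤ y) (h1 : y ≤ 4 * q) : AVis q 0 (apt q 1 y) := by
  by_cases hc0 : y ≤ 2 * q - 1
  · exact zig_odd (by omega) (segA1 hq) y (2 * q - 1 - y) (by omega) (by omega) (by omega)
  by_cases hc1 : y ≤ 3 * q - 1
  · exact zig_odd (by omega) (segB2 hq) y (3 * q - 1 - y) (by omega) (by omega) (by omega)
  by_cases hc2 : y ≤ 4 * q - 1
  · exact zig_even (by omega) (segB2 hq) y (y - 3 * q) (by omega) (by omega) (by omega)
  exact by have := pt_vis (ptA6 hq) (by omega); rwa [show y = 4 * q by omega]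

theorem vis02 (hq : 1 ≤ q) (y : ℤ) (h0 : 0 ≤ y) (h1 : y ≤ 4 * q) : AVis q 0 (apt q 2 y) := by
  by_cases hc0 : y = 0
  · exact by have := pt_vis (ptB4 hq) (by omega); rwa [show y = 0 by omega]
  by_cases hc1 : y ≤ 2 * q
  · exact zig_even (by omega) (segB1 hq) y (2 * q - y) (by omega) (by omega) (by omega)
  by_cases hc2 : y ≤ 3 * q
  · exact zig_even (by omega) (segA3 hq) y (3 * q - y) (by omega) (by omega) (by omega)
  by_cases hc3 : y ≤ 4 * q - 1
  · exact zig_odd (by omega) (segA3 hq) y (y - (3 * q + 1)) (by omega) (by omega) (by omega)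
  exact by have := pt_vis (ptA7 hq) (by omega); rwa [show y = 4 * q by omega]

theorem vis03 (hq : 1 ≤ q) (y : ℤ) (h0 : 0 ≤ y) (h1 : y ≤ 4 * q) : AVis q 0 (apt q 3 y) := by
  by_cases hc0 : y = 0
  · exact by have := pt_vis (ptB6 hq) (by omega); rwa [show y = 0 by omega]
  by_cases hc1 : y ≤ 2 * q
  · exact zig_odd (by omega) (segB1 hq) y (y - 1) (by omega) (by omega) (by omega)
  by_cases hc2 : y ≤ 3 * q
  · exact zig_even (by omega) (segB3 hq) y (3 * q - y) (by omega) (by omega) (by omega)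
  by_cases hc3 : y = 3 * q + 1
  · exact by have := pt_vis (ptB5 hq) (by omega); rwa [show y = 3 * q + 1 by omega]
  exact zig_odd (by omega) (segB3 hq) y (y - (3 * q + 2)) (by omega) (by omega) (by omega)

theorem vis10 (hq : 1 ≤ q) (y : ℤ) (h0 : 1 ≤ y) (h1 : y ≤ 4 * q) : AVis q 1 (apt q 0 y) := by
  by_cases hc0 : y ≤ 2 * q
  · exact zig_odd (by omega) (segC1 hq) y (y - 1) (by omega) (by omega) (by omega)
  exact zig_even (by omega) (segC2 hq) y (y - (2 * q + 1)) (by omega) (by omega) (by omega)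

theorem vis11 (hq : 1 ≤ q) (y : ℤ) (h0 : 0 ≤ y) (h1 : y ≤ 4 * q) : AVis q 1 (apt q 1 y) := by
  by_cases hc0 : y ≤ q - 2
  · exact zig_odd (by omega) (segD1 hq) y (q - 2 - y) (by omega) (by omega) (by omega)
  by_cases hc1 : y ≤ 3 * q - 2
  · exact zig_even (by omega) (segD2 hq) y (y - (q - 1)) (by omega) (by omega) (by omega)
  by_cases hc2 : y = 3 * q - 1
  · exact by have := pt_vis (ptC4 hq) (by omega); rwa [show y = 3 * q - 1 by omega]
  exact (zig_odd (by omega) (segD1 hq) (y - (4 * q + 1)) (q - 2 - (y - (4 * q + 1))) (by omega) (by omega) (by omega)).shift y (by omega)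

theorem vis12 (hq : 1 ≤ q) (y : ℤ) (h0 : 0 ≤ y) (h1 : y ≤ 4 * q) : AVis q 1 (apt q 2 y) := by
  by_cases hc0 : y ≤ 2 * q - 2
  · exact zig_odd (by omega) (segD2 hq) y (2 * q - 2 - y) (by omega) (by omega) (by omega)
  by_cases hc1 : y = 2 * q - 1
  · exact by have := pt_vis (ptD3 hq) (by omega); rwa [show y = 2 * q - 1 by omega]
  by_cases hc2 : y ≤ 4 * q - 1
  · exact zig_even (by omega) (segC1 hq) y (4 * q - 1 - y) (by omega) (by omega) (by omega)
  exact (zig_odd (by omega) (segD2 hq) (y - (4 * q + 1)) (2 * q - 2 - (y - (4 * q + 1))) (by omega) (by omega) (by omega)).shift y (by omega)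

theorem vis13 (hq : 1 ≤ q) (y : ℤ) (h0 : 0 ≤ y) (h1 : y ≤ 4 * q) : AVis q 1 (apt q 3 y) := by
  by_cases hc0 : y ≤ 2 * q - 1
  · exact zig_odd (by omega) (segC2 hq) y (2 * q - 1 - y) (by omega) (by omega) (by omega)
  by_cases hc1 : y = 2 * q
  · exact by have := pt_vis (ptC3 hq) (by omega); rwa [show y = 2 * q by omega]
  exact zig_even (by omega) (segD1 hq) y (y - (2 * q + 1)) (by omega) (by omega) (by omega)

theorem dif01 (hq : 1 ≤ q) (d : ℤ) (h0 : 0 ≤ d) (h1 : d ≤ 4 * q)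
    (h2 : d ≠ 2 * q) (h3 : d ≠ 2 * q + 1) :
    ADif q 0 1 d := by
  by_cases hc0 : d ≤ 2 * q - 2
  · exact zig_dif (by omega) (segA1 hq) d (2 * q - 2 - d) (by omega) (by omega) (by omega)
  by_cases hc1 : d = 2 * q - 1
  · exact ADif.of_edge (link (4 * q) (4 * q + 1) (by omega) (by omega) (ptA6 hq) (ptA10 hq)).symm d (by omega)
  by_cases hc2 : d = 2 * q + 2
  · exact (ADif.of_edge (link (4 * q - 3) (4 * q - 2) (by omega) (by omega) (ptA9 hq) (ptA4 hq)).symm (d - (4 * q + 1)) (by omega)).shift d (by omega)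
  exact (zig_dif (by omega) (segA1 hq) (d - (4 * q + 1)) (2 * q - 2 - (d - (4 * q + 1))) (by omega) (by omega) (by omega)).shift d (by omega)

theorem dif02 (hq : 1 ≤ q) (d : ℤ) (h0 : 0 ≤ d) (h1 : d ≤ 4 * q) :
    ADif q 0 2 d := by
  by_cases hc0 : d ≤ 4 * q - 2
  · exact (zig_dif (by omega) (segC1 hq) (-d) (4 * q - 2 - d) (by omega) (by omega) (by omega)).symm d (by omega)
  by_cases hc1 : d = 4 * q
  · exact (ADif.of_edge (link (6 * q + 1) (6 * q + 2) (by omega) (by omega) (ptA11 hq) (ptA12 hq)) (d - (4 * q + 1)) (by omega)).shift d (by omega)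
  exact ADif.of_edge (wrap (ptA7 hq) (ptA8 hq)).symm d (by omega)

theorem dif03 (hq : 1 ≤ q) (d : ℤ) (h0 : 0 ≤ d) (h1 : d ≤ 4 * q) :
    ADif q 0 3 d := by
  by_cases hc0 : d = 0
  · exact ADif.of_edge (link (4 * q - 1) (4 * q) (by omega) (by omega) (ptC6 hq) (ptC3 hq)) d (by omega)
  by_cases hc1 : d = 4 * q
  · exact (ADif.of_edge (link (4 * q) (4 * q + 1) (by omega) (by omega) (ptC3 hq) (ptC7 hq)).symm (d - (4 * q + 1)) (by omega)).shift d (by omega)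
  exact (zig_dif (by omega) (segC2 hq) (d - (4 * q + 1)) (-2 - (d - (4 * q + 1))) (by omega) (by omega) (by omega)).shift d (by omega)

theorem dif12 (hq : 1 ≤ q) (d : ℤ) (h0 : 0 ≤ d) (h1 : d ≤ 4 * q) :
    ADif q 1 2 d := by
  by_cases hc0 : d ≤ q - 1
  · exact zig_dif (by omega) (segD2 hq) d (q - 1 - d) (by omega) (by omega) (by omega)
  by_cases hc1 : d = q
  · exact ADif.of_edge (wrap (ptC4 hq) (ptC5 hq)) d (by omega)
  by_cases hc2 : d = q + 1
  · exact (ADif.of_edge (link (4 * q) (4 * q + 1) (by omega) (by omega) (ptB4 hq) (ptB9 hq)).symm (d - (4 * q + 1)) (by omega)).shift d (by omega)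
  exact (zig_dif (by omega) (segD2 hq) (d - (4 * q + 1)) (q - 1 - (d - (4 * q + 1))) (by omega) (by omega) (by omega)).shift d (by omega)

theorem dif13 (hq : 1 ≤ q) (d : ℤ) (h0 : 0 ≤ d) (h1 : d ≤ 4 * q) :
    ADif q 1 3 d := by
  by_cases hc0 : d = q + 1
  · exact ADif.of_edge (link (6 * q) (6 * q + 1) (by omega) (by omega) (ptB10 hq) (ptB5 hq)) d (by omega)
  by_cases hc1 : d = q + 2
  · exact (ADif.of_edge (link (8 * q) (8 * q + 1) (by omega) (by omega) (ptC8 hq) (ptC4 hq)).symm (d - (4 * q + 1)) (by omega)).shift d (by omega)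
  by_cases hc2 : d ≤ q
  · exact ((zig_dif (by omega) (segD1 hq) (-d - (4 * q + 1)) (d + (4 * q + 1) - q - 3) (by omega) (by omega) (by omega)).shift (-d) (by omega)).symm d (by omega)
  exact (zig_dif (by omega) (segD1 hq) (-d) (d - q - 3) (by omega) (by omega) (by omega)).symm d (by omega)

theorem dif23 (hq : 1 ≤ q) (d : ℤ) (h0 : 0 ≤ d) (h1 : d ≤ 4 * q) :
    ADif q 2 3 d := by
  by_cases hc0 : d ≤ 2 * q - 1
  · exact zig_dif (by omega) (segB1 hq) d (d + 2 * q - 1) (by omega) (by omega) (by omega)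
  by_cases hc1 : d = 2 * q
  · exact ADif.of_edge (link (4 * q - 1) (4 * q) (by omega) (by omega) (ptB8 hq) (ptB4 hq)).symm d (by omega)
  by_cases hc2 : d = 2 * q + 1
  · exact (ADif.of_edge (wrap (ptB6 hq) (ptB7 hq)).symm (d - (4 * q + 1)) (by omega)).shift d (by omega)
  exact (zig_dif (by omega) (segB1 hq) (d - (4 * q + 1)) (d - (4 * q + 1) + 2 * q - 1) (by omega) (by omega) (by omega)).shift d (by omega)

theorem dif00 (hq : 1 ≤ q) (d : ℤ) (h0 : 1 ≤ d) (h1 : d ≤ 2 * q) :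
    ADif q 0 0 d := by
  exact zig_dif (by omega) (segA2 hq) d (2 * q - d) (by omega) (by omega) (by omega)

theorem dif11 (hq : 1 ≤ q) (d : ℤ) (h0 : 1 ≤ d) (h1 : d ≤ 2 * q) :
    ADif q 1 1 d := by
  by_cases hc0 : d ≤ 2 * q - 1
  · exact (zig_dif (by omega) (segB2 hq) (-d) (d - 1) (by omega) (by omega) (by omega)).symm d (by omega)
  exact ADif.of_edge (link (4 * q - 1) (4 * q) (by omega) (by omega) (ptD6 hq) (ptD7 hq)) d (by omega)

theorem dif22 (hq : 1 ≤ q) (d : ℤ) (h0 : 1 ≤ d) (h1 : d ≤ 2 * q) :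
    ADif q 2 2 d := by
  by_cases hc0 : d ≤ 2 * q - 2
  · exact zig_dif (by omega) (segA3 hq) d (d - 1) (by omega) (by omega) (by omega)
  by_cases hc1 : d = 2 * q - 1
  · exact ADif.of_edge (link (8 * q) (8 * q + 1) (by omega) (by omega) (ptA13 hq) (ptA7 hq)) d (by omega)
  exact ADif.of_edge (link (8 * q - 1) (8 * q) (by omega) (by omega) (ptD8 hq) (ptD3 hq)) d (by omega)

theorem dif33 (hq : 1 ≤ q) (d : ℤ) (h0 : 1 ≤ d) (h1 : d ≤ 2 * q) :
    ADif q 3 3 d := by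
  by_cases hc0 : d = 1
  · exact ADif.of_edge (link (6 * q + 1) (6 * q + 2) (by omega) (by omega) (ptB5 hq) (ptB11 hq)).symm d (by omega)
  by_cases hc1 : d ≤ 2 * q - 1
  · exact zig_dif (by omega) (segB3 hq) d (d - 2) (by omega) (by omega) (by omega)
  exact (ADif.of_edge (link (8 * q) (8 * q + 1) (by omega) (by omega) (ptB12 hq) (ptB6 hq)) (d - (4 * q + 1)) (by omega)).shift d (by omega)

theorem inf_edge (hq : 1 ≤ q) (l : Fin 4) : ∃ x : ℤ, AEdg q none (apt q l x) := by
  fin_cases l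
  · exact ⟨_, (link (4 * q - 2) (4 * q - 1) (by omega) (by omega) (ptA4 hq) (ptA5 hq)).symm⟩
  · exact ⟨_, link (4 * q - 1) (4 * q) (by omega) (by omega) (ptA5 hq) (ptA6 hq)⟩
  · exact ⟨_, (link (8 * q) (8 * q + 1) (by omega) (by omega) (ptD3 hq) (ptD4 hq)).symm⟩
  · exact ⟨_, wrap (ptD4 hq) (ptD5 hq)⟩

end segments

/-- Translation by `g`. -/
def ashift (q : ℕ) (g : ZMod (4 * q + 1)) : ArcV q → ArcV q :=
  Option.map (fun x => (x.1, x.2 + g))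

/-- The half-parallel class cycle. -/
def arcH (q p : ℕ) : ArcV q :=
  if p % 2 = 0 then apt q 0 (p / 2 : ℕ) else apt q 1 ((p / 2 : ℕ) + 2 * q + 1)

theorem exists_rep (q : ℕ) (x : ZMod (4 * q + 1)) :
    ∃ y : ℤ, 0 ≤ y ∧ y ≤ 4 * q ∧ (y : ZMod (4 * q + 1)) = x :=
  ⟨(x.val : ℤ), by omega, by have := ZMod.val_lt x; omega, by simp⟩

theorem vis_all {q : ℕ} (hq : 1 ≤ q) (c : Fin 2) (u : ArcV q)
    (hu : u ≠ if c = 0 then apt q 1 0 else apt q 0 0) : AVis q c u := by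
  rcases u with _ | ⟨l, x⟩
  · fin_cases c
    · exact pt_vis (ptA5 hq) (by omega)
    · exact pt_vis (ptD4 hq) (by omega)
  · obtain ⟨y, h0, h1, rfl⟩ := exists_rep q x
    change AVis q c (apt q l y)
    change apt q l y ≠ _ at hu
    fin_cases c <;> fin_cases l <;> simp at hu ⊢
    · exact vis00 hq y h0 h1
    · refine vis01 hq y ?_ h1
      rcases h0.lt_or_eq with h | h
      · omega
      · exact absurd (by rw [← h]) hu
    · exact vis02 hq y h0 h1
    · exact vis03 hq y h0 h1
    · refine vis10 hq y ?_ h1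
      rcases h0.lt_or_eq with h | h
      · omega
      · exact absurd (by rw [← h]) hu
    · exact vis11 hq y h0 h1
    · exact vis12 hq y h0 h1
    · exact vis13 hq y h0 h1

/-- Edges developed from the base cycles, or in the half-parallel class. -/
def Cov (q : ℕ) (u u' : ArcV q) : Prop :=
  (∃ g a b, AEdg q a b ∧ u = ashift q g a ∧ u' = ashift q g b) ∨
    ∃ p, p < 8 * q + 2 ∧ s(u, u') = s(arcH q p, arcH q ((p + 1) % (8 * q + 2)))

theorem Cov.symm {q : ℕ} {u u' : ArcV q} (h : Cov q u u') : Cov q u' u := by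
  rcases h with ⟨g, a, b, h, h1, h2⟩ | ⟨p, hp, h⟩
  · exact Or.inl ⟨g, b, a, h.symm, h2, h1⟩
  · exact Or.inr ⟨p, hp, by rw [← h, Sym2.eq_swap]⟩

theorem ADif.cov {q : ℕ} {i j : Fin 4} {d : ℤ} (h : ADif q i j d) (x y : ZMod (4 * q + 1))
    (hd : (d : ZMod (4 * q + 1)) = y - x) : Cov q (some (i, x)) (some (j, y)) := by
  obtain ⟨z, h⟩ := h
  refine Or.inl ⟨x - z, _, _, h, ?_, ?_⟩
  · simp [apt, ashift]
  · simp [apt, ashift, hd]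
    ring

theorem cov_hpc {q : ℕ} (x y : ZMod (4 * q + 1)) (d : ℤ) (hd : (d : ZMod (4 * q + 1)) = y - x)
    (h : d = 2 * q ∨ d = 2 * q + 1) : Cov q (some (0, x)) (some (1, y)) := by
  have hn : ((4 * q + 1 : ℕ) : ZMod (4 * q + 1)) = 0 := ZMod.natCast_self _
  have hy : y = x + d := by rw [hd]; ring
  right
  rcases h with rfl | rfl
  · have hlt := ZMod.val_lt (x - 1)
    have hv : (((x - 1).val : ℕ) : ZMod (4 * q + 1)) = x - 1 := ZMod.natCast_zmod_val _
    refine ⟨2 * (x - 1).val + 1, by omega, ?_⟩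
    have e1 : arcH q (2 * (x - 1).val + 1) = some (1, y) := by
      rw [arcH, if_neg (by omega), show (2 * (x - 1).val + 1) / 2 = (x - 1).val by omega, apt, hy]
      push_cast
      rw [hv]
      congr 2
      ring
    have e2 : arcH q ((2 * (x - 1).val + 1 + 1) % (8 * q + 2)) = some (0, x) := by
      by_cases hm : (x - 1).val = 4 * q
      · rw [hm, show (2 * (4 * q) + 1 + 1) % (8 * q + 2) = 0 by
          rw [show 2 * (4 * q) + 1 + 1 = 8 * q + 2 by ring, Nat.mod_self]]
        rw [hm] at hv
        rw [arcH, if_pos (by omega), apt]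
        push_cast at hn hv
        have : x = 0 := by
          have : x = (4 * q : ZMod (4 * q + 1)) + 1 := by rw [hv]; ring
          rw [this, hn]
        simp [this]
      · rw [Nat.mod_eq_of_lt (by omega), arcH, if_pos (by omega),
          show (2 * (x - 1).val + 1 + 1) / 2 = (x - 1).val + 1 by omega, apt]
        push_cast
        rw [hv]
        simp
    rw [e1, e2, Sym2.eq_swap]
  · have hlt := ZMod.val_lt x
    have hv : ((x.val : ℕ) : ZMod (4 * q + 1)) = x := ZMod.natCast_zmod_val _
    refine ⟨2 * x.val, by omega, ?_⟩
    rw [Nat.mod_eq_of_lt (by omega), arcH, arcH, if_pos (by omega), if_neg (by omega),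
      show 2 * x.val / 2 = x.val by omega, show (2 * x.val + 1) / 2 = x.val by omega, apt, apt, hy]
    push_cast
    rw [hv, add_assoc]

theorem cov_mixed {q : ℕ} (hq : 1 ≤ q) (i j : Fin 4) (hij : i < j) (x y : ZMod (4 * q + 1)) :
    Cov q (some (i, x)) (some (j, y)) := by
  obtain ⟨d, h0, h1, hd⟩ := exists_rep q (y - x)
  fin_cases i <;> fin_cases j <;> first | (exact absurd hij (by decide)) | skip
  · by_cases h2 : d = 2 * q
    · exact cov_hpc x y d hd (Or.inl h2)
    by_cases h3 : d = 2 * q + 1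
    · exact cov_hpc x y d hd (Or.inr h3)
    exact (dif01 hq d h0 h1 h2 h3).cov x y hd
  · exact (dif02 hq d h0 h1).cov x y hd
  · exact (dif03 hq d h0 h1).cov x y hd
  · exact (dif12 hq d h0 h1).cov x y hd
  · exact (dif13 hq d h0 h1).cov x y hd
  · exact (dif23 hq d h0 h1).cov x y hd

theorem dif_pure {q : ℕ} (hq : 1 ≤ q) (i : Fin 4) (d : ℤ) (h0 : 1 ≤ d) (h1 : d ≤ 2 * q) :
    ADif q i i d := by
  fin_cases i
  · exact dif00 hq d h0 h1
  · exact dif11 hq d h0 h1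
  · exact dif22 hq d h0 h1
  · exact dif33 hq d h0 h1

theorem cov_pure {q : ℕ} (hq : 1 ≤ q) (i : Fin 4) (x y : ZMod (4 * q + 1)) (hxy : x ≠ y) :
    Cov q (some (i, x)) (some (i, y)) := by
  obtain ⟨d, h0, h1, hd⟩ := exists_rep q (y - x)
  have hd0 : d ≠ 0 := by
    rintro rfl
    rw [Int.cast_zero] at hd
    exact hxy (sub_eq_zero.1 hd.symm).symm
  by_cases h2 : d ≤ 2 * q
  · exact (dif_pure hq i d (by omega) h2).cov x y hd
  · exact (((dif_pure hq i (4 * q + 1 - d) (by omega) (by omega)).symm (d - (4 * q + 1))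
      (by ring)).shift d (by ring)).cov x y hd

theorem cov_inf {q : ℕ} (hq : 1 ≤ q) (i : Fin 4) (x : ZMod (4 * q + 1)) :
    Cov q none (some (i, x)) := by
  obtain ⟨z, h⟩ := inf_edge hq i
  exact Or.inl ⟨x - z, _, _, h, by simp [ashift], by simp [ashift, apt]⟩

theorem cov_all {q : ℕ} (hq : 1 ≤ q) (u u' : ArcV q) (h : u ≠ u') : Cov q u u' := by
  rcases u with _ | ⟨i, x⟩ <;> rcases u' with _ | ⟨j, y⟩
  · exact absurd rfl h
  · exact cov_inf hq j y
  · exact (cov_inf hq i x).symm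
  · rcases lt_trichotomy i j with hij | rfl | hij
    · exact cov_mixed hq i j hij x y
    · exact cov_pure hq i x y (fun hh => h (by rw [hh]))
    · exact (cov_mixed hq j i hij y x).symm

theorem ashift_neg {q : ℕ} (g : ZMod (4 * q + 1)) (u : ArcV q) :
    ashift q g (ashift q (-g) u) = u := by
  rcases u with _ | ⟨i, x⟩ <;> simp [ashift]

theorem arcH_inj {q p p' : ℕ} (hp : p < 8 * q + 2) (hp' : p' < 8 * q + 2)
    (h : arcH q p = arcH q p') : p = p' := by
  have key : ∀ a b : ℕ, a < 4 * q + 1 → b < 4 * q + 1 →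
      (a : ZMod (4 * q + 1)) = b → a = b := by
    intro a b ha hb hab
    have := (ZMod.natCast_eq_natCast_iff' _ _ _).1 hab
    rwa [Nat.mod_eq_of_lt ha, Nat.mod_eq_of_lt hb] at this
  unfold arcH at h
  split_ifs at h with h1 h2 h2
  · simp only [apt, Option.some.injEq, Prod.mk.injEq, true_and, Int.cast_natCast] at h
    have := key _ _ (by omega) (by omega) h
    omega
  · simp [apt] at h
  · simp [apt] at h
  · simp only [apt, Option.some.injEq, Prod.mk.injEq, true_and] at h
    simp only [Int.cast_add, add_left_inj, Int.cast_natCast] at h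
    have := key (p / 2) (p' / 2) (by omega) (by omega) h
    omega

theorem hasARCS_eight (q : ℕ) (hq : 1 ≤ q) : HasARCS (8 * q + 2) (2 * (8 * q + 2) + 1) := by
  have hk : 0 < 8 * q + 2 := by omega
  have : NeZero (8 * q + 2) := ⟨hk.ne'⟩
  have hsucc : ∀ p : ℕ, (((p : ZMod (8 * q + 2)) + 1).val) = (p + 1) % (8 * q + 2) := by
    intro p
    rw [← Nat.cast_succ, ZMod.val_natCast]
  refine hasARCS_of_cover (8 * q + 2) hk (V := ArcV q) (I := ZMod (4 * q + 1) × Fin 2)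
    ?_ ?_ (fun i j p => ashift q i.1 (arcW q i.2 j p.val)) (fun p => arcH q p.val) ?_
    (fun i => ashift q i.1 (if i.2 = 0 then apt q 1 0 else apt q 0 0)) ?_ ?_
  · simp [ZMod.card]; ring
  · simp [ZMod.card]; ring
  · intro p p' h
    exact ZMod.val_injective _ (arcH_inj (ZMod.val_lt p) (ZMod.val_lt p') h)
  · rintro ⟨g, c⟩ u hu
    have hv := vis_all hq c (ashift q (-g) u) (by
      intro hh
      apply hu
      simp only
      rw [← hh, ashift_neg])
    obtain ⟨j, p, hp, h⟩ := hv
    refine ⟨j, (p : ZMod (8 * q + 2)), ?_⟩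
    simp only
    rw [ZMod.val_natCast, Nat.mod_eq_of_lt hp, h, ashift_neg]
  · intro u u' hne
    rcases cov_all hq u u' hne with ⟨g, a, b, ⟨c, j, p, hp, h⟩, rfl, rfl⟩ | ⟨p, hp, h⟩
    · left
      refine ⟨(g, c), j, (p : ZMod (8 * q + 2)), ?_⟩
      simp only
      rw [hsucc, ZMod.val_natCast, Nat.mod_eq_of_lt hp]
      exact congrArg (Sym2.map (ashift q g)) h
    · right
      refine ⟨(p : ZMod (8 * q + 2)), ?_⟩
      rw [hsucc, ZMod.val_natCast, Nat.mod_eq_of_lt hp]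
      exact h

/-- For every `k ≥ 26` with `k ≡ 2 (mod 24)`, there exists an almost resolvable
`k`-cycle system of order `2k+1`. -/
theorem arcs_mod24_case_2 (k : ℕ) (hk : 26 ≤ k) (hk24 : k % 24 = 2) :
    HasARCS k (2 * k + 1) := by
  obtain ⟨q, rfl⟩ : ∃ q, k = 8 * q + 2 := ⟨(k - 2) / 8, by omega⟩
  exact hasARCS_eight q (by omega)
end

section
/- For every k ≥ 34 with k ≡ 10 (mod 24), there exists an almost resolvable k-cycle system of order 2k+1. -/
namespace ARCS

/-- First base cycle of the first class (vertices are pairs (orbit, coordinate), orbit 4 is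
the fixed point; coordinates are read modulo `4 * s + 1`).
The value at `8 * s + 2` closes the cycle. -/
def cycA (s n : ℕ) : ℕ × ℕ :=
  if n ≤ 4 * s then
    (if n % 2 = 0 then (2, n / 2) else (1, 2 * s - n / 2))
  else if n = 4 * s + 1 then (3, 2 * s + 1)
  else if n ≤ 8 * s + 1 then
    (if n % 2 = 0 then (3, n / 2 - 2 * s) else (2, 6 * s + 1 - n / 2))
  else (2, 0)

/-- Second base cycle of the first class. -/
def cycB (s n : ℕ) : ℕ × ℕ :=
  if n = 0 then (0, 0)
  else if n ≤ 4 * s then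
    (if n % 2 = 0 then (1, 2 * s + n / 2) else (0, 4 * s - n / 2))
  else if n = 4 * s + 1 then (1, 0)
  else if n ≤ 6 * s then
    (if n % 2 = 0 then (0, 4 * s + 1 - n / 2) else (0, n / 2 - 2 * s))
  else if n ≤ 8 * s then
    (if n % 2 = 0 then (3, n / 2 + 1 - s) else (3, 7 * s + 1 - n / 2))
  else if n = 8 * s + 1 then (4, 0)
  else (0, 0)

/-- First base cycle of the second class. -/
def cycC (s n : ℕ) : ℕ × ℕ :=
  if n ≤ 4 * s + 1 then
    (if n % 2 = 0 then (1, 4 * s + 1 - n / 2) else (3, 2 * s + n / 2))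
  else if n ≤ 6 * s + 1 then
    (if n % 2 = 0 then (2, 6 * s + 1 - n / 2) else (2, n / 2 - 2 * s - 1))
  else if n = 6 * s + 2 then (4, 0)
  else if n ≤ 8 * s + 1 then
    (if n % 2 = 0 then (1, 4 * s + 1 - n / 2) else (1, n / 2 - 2 * s))
  else (1, 4 * s + 1)

/-- Second base cycle of the second class. -/
def cycD (s n : ℕ) : ℕ × ℕ :=
  if n = 0 then (2, s)
  else if n ≤ 4 * s - 1 then
    (if n % 2 = 0 then (3, 2 * s - 1 - n / 2) else (0, n / 2 + 3 * s + 2))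
  else if n = 4 * s then (2, 3 * s)
  else if n = 4 * s + 1 then (1, s)
  else if n = 4 * s + 2 then (0, 3 * s + 1)
  else if n ≤ 8 * s + 1 then
    (if n % 2 = 0 then (2, 5 * s + 1 - n / 2) else (0, n / 2 - s))
  else (2, s)

/-- The four base cycles: class `h`, cycle `j`. -/
def cyc (s : ℕ) (h j : Fin 2) (n : ℕ) : ℕ × ℕ :=
  if h = 0 then (if j = 0 then cycA s n else cycB s n)
  else (if j = 0 then cycC s n else cycD s n)

/-- `p` is in orbit `i`, `q` in orbit `j` and their difference is `d` modulo `4 * s + 1`. -/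
def Rel (s i j d : ℕ) (p q : ℕ × ℕ) : Prop :=
  p.1 = i ∧ q.1 = j ∧
    (q.2 = p.2 + d ∨ q.2 + (4 * s + 1) = p.2 + d ∨ q.2 + 2 * (4 * s + 1) = p.2 + d)

/-- The difference `d` between the orbits `i` and `j` is covered by a base cycle. -/
def Cov (s i j d : ℕ) : Prop :=
  ∃ (h l : Fin 2) (n : ℕ), n < 8 * s + 2 ∧
    (Rel s i j d (cyc s h l n) (cyc s h l (n + 1)) ∨
     Rel s i j d (cyc s h l (n + 1)) (cyc s h l n))

/-- The orbit `i` is joined to the fixed point in a base cycle. -/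
def CovInf (s i : ℕ) : Prop :=
  ∃ (h l : Fin 2) (n : ℕ), n < 8 * s + 2 ∧
    ((cyc s h l n).1 = i ∧ (cyc s h l (n + 1)).1 = 4 ∨
     (cyc s h l (n + 1)).1 = i ∧ (cyc s h l n).1 = 4)

/-- The vertex `x` of orbit `i` is covered by a cycle of class `h`. -/
def Vert (s : ℕ) (h : Fin 2) (i x : ℕ) : Prop :=
  ∃ (l : Fin 2) (n : ℕ), n < 8 * s + 2 ∧ (cyc s h l n).1 = i ∧
    ((cyc s h l n).2 = x ∨ (cyc s h l n).2 = x + (4 * s + 1))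

theorem cov_mk {s i j d n y z : ℕ} {h l : Fin 2} (h1 : cyc s h l n = (i, y))
    (h2 : cyc s h l (n + 1) = (j, z)) (hn : n < 8 * s + 2 := by omega)
    (hd : z = y + d ∨ z + (4 * s + 1) = y + d ∨ z + 2 * (4 * s + 1) = y + d := by omega) :
    Cov s i j d :=
  ⟨h, l, n, hn, Or.inl (by rw [h1, h2]; exact ⟨rfl, rfl, hd⟩)⟩

theorem cov_mk_rev {s i j d n y z : ℕ} {h l : Fin 2} (h1 : cyc s h l n = (j, z))
    (h2 : cyc s h l (n + 1) = (i, y)) (hn : n < 8 * s + 2 := by omega)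
    (hd : z = y + d ∨ z + (4 * s + 1) = y + d ∨ z + 2 * (4 * s + 1) = y + d := by omega) :
    Cov s i j d :=
  ⟨h, l, n, hn, Or.inr (by rw [h1, h2]; exact ⟨rfl, rfl, hd⟩)⟩

theorem covInf_mk {s i n y z : ℕ} {h l : Fin 2} (h1 : cyc s h l n = (i, y))
    (h2 : cyc s h l (n + 1) = (4, z)) (hn : n < 8 * s + 2 := by omega) : CovInf s i :=
  ⟨h, l, n, hn, Or.inl (by rw [h1, h2]; exact ⟨rfl, rfl⟩)⟩

theorem covInf_mk_rev {s i n y z : ℕ} {h l : Fin 2} (h1 : cyc s h l n = (4, z))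
    (h2 : cyc s h l (n + 1) = (i, y)) (hn : n < 8 * s + 2 := by omega) : CovInf s i :=
  ⟨h, l, n, hn, Or.inr (by rw [h1, h2]; exact ⟨rfl, rfl⟩)⟩

theorem vert_mk {s i n x y : ℕ} {h l : Fin 2} (h1 : cyc s h l n = (i, y))
    (hn : n < 8 * s + 2 := by omega) (hy : y = x ∨ y = x + (4 * s + 1) := by omega) :
    Vert s h i x :=
  ⟨l, n, hn, by rw [h1]; exact ⟨rfl, hy⟩⟩

theorem valA0e (s n : ℕ) (h : 1 ≤ s ∧ n ≤ 4 * s ∧ n % 2 = 0 := by omega) :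
    cyc s 0 0 n = (2, n / 2) := by
  change cycA s n = _
  unfold cycA; split_ifs <;> first | rfl | omega

theorem valA0o (s n : ℕ) (h : 1 ≤ s ∧ n ≤ 4 * s ∧ n % 2 = 1 := by omega) :
    cyc s 0 0 n = (1, 2 * s - n / 2) := by
  change cycA s n = _
  unfold cycA; split_ifs <;> first | rfl | omega

theorem valA1 (s n : ℕ) (h : 1 ≤ s ∧ n = 4 * s + 1 := by omega) :
    cyc s 0 0 n = (3, 2 * s + 1) := by
  change cycA s n = _
  unfold cycA; split_ifs <;> first | rfl | omega

theorem valA2e (s n : ℕ) (h : 1 ≤ s ∧ 4 * s + 2 ≤ n ∧ n ≤ 8 * s + 1 ∧ n % 2 = 0 := by omega) :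
    cyc s 0 0 n = (3, n / 2 - 2 * s) := by
  change cycA s n = _
  unfold cycA; split_ifs <;> first | rfl | omega

theorem valA2o (s n : ℕ) (h : 1 ≤ s ∧ 4 * s + 2 ≤ n ∧ n ≤ 8 * s + 1 ∧ n % 2 = 1 := by omega) :
    cyc s 0 0 n = (2, 6 * s + 1 - n / 2) := by
  change cycA s n = _
  unfold cycA; split_ifs <;> first | rfl | omega

theorem valA3 (s n : ℕ) (h : 1 ≤ s ∧ n = 8 * s + 2 := by omega) :
    cyc s 0 0 n = (2, 0) := by
  change cycA s n = _
  unfold cycA; split_ifs <;> first | rfl | omega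

theorem valB0 (s n : ℕ) (h : 1 ≤ s ∧ n = 0 := by omega) :
    cyc s 0 1 n = (0, 0) := by
  change cycB s n = _
  unfold cycB; split_ifs <;> first | rfl | omega

theorem valB1e (s n : ℕ) (h : 1 ≤ s ∧ 1 ≤ n ∧ n ≤ 4 * s ∧ n % 2 = 0 := by omega) :
    cyc s 0 1 n = (1, 2 * s + n / 2) := by
  change cycB s n = _
  unfold cycB; split_ifs <;> first | rfl | omega

theorem valB1o (s n : ℕ) (h : 1 ≤ s ∧ 1 ≤ n ∧ n ≤ 4 * s ∧ n % 2 = 1 := by omega) :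
    cyc s 0 1 n = (0, 4 * s - n / 2) := by
  change cycB s n = _
  unfold cycB; split_ifs <;> first | rfl | omega

theorem valB2 (s n : ℕ) (h : 1 ≤ s ∧ n = 4 * s + 1 := by omega) :
    cyc s 0 1 n = (1, 0) := by
  change cycB s n = _
  unfold cycB; split_ifs <;> first | rfl | omega

theorem valB3e (s n : ℕ) (h : 1 ≤ s ∧ 4 * s + 2 ≤ n ∧ n ≤ 6 * s ∧ n % 2 = 0 := by omega) :
    cyc s 0 1 n = (0, 4 * s + 1 - n / 2) := by
  change cycB s n = _
  unfold cycB; split_ifs <;> first | rfl | omega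

theorem valB3o (s n : ℕ) (h : 1 ≤ s ∧ 4 * s + 2 ≤ n ∧ n ≤ 6 * s ∧ n % 2 = 1 := by omega) :
    cyc s 0 1 n = (0, n / 2 - 2 * s) := by
  change cycB s n = _
  unfold cycB; split_ifs <;> first | rfl | omega

theorem valB4e (s n : ℕ) (h : 1 ≤ s ∧ 6 * s + 1 ≤ n ∧ n ≤ 8 * s ∧ n % 2 = 0 := by omega) :
    cyc s 0 1 n = (3, n / 2 + 1 - s) := by
  change cycB s n = _
  unfold cycB; split_ifs <;> first | rfl | omega

theorem valB4o (s n : ℕ) (h : 1 ≤ s ∧ 6 * s + 1 ≤ n ∧ n ≤ 8 * s ∧ n % 2 = 1 := by omega) :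
    cyc s 0 1 n = (3, 7 * s + 1 - n / 2) := by
  change cycB s n = _
  unfold cycB; split_ifs <;> first | rfl | omega

theorem valB5 (s n : ℕ) (h : 1 ≤ s ∧ n = 8 * s + 1 := by omega) :
    cyc s 0 1 n = (4, 0) := by
  change cycB s n = _
  unfold cycB; split_ifs <;> first | rfl | omega

theorem valB6 (s n : ℕ) (h : 1 ≤ s ∧ n = 8 * s + 2 := by omega) :
    cyc s 0 1 n = (0, 0) := by
  change cycB s n = _
  unfold cycB; split_ifs <;> first | rfl | omega

theorem valC0e (s n : ℕ) (h : 1 ≤ s ∧ n ≤ 4 * s + 1 ∧ n % 2 = 0 := by omega) :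
    cyc s 1 0 n = (1, 4 * s + 1 - n / 2) := by
  change cycC s n = _
  unfold cycC; split_ifs <;> first | rfl | omega

theorem valC0o (s n : ℕ) (h : 1 ≤ s ∧ n ≤ 4 * s + 1 ∧ n % 2 = 1 := by omega) :
    cyc s 1 0 n = (3, 2 * s + n / 2) := by
  change cycC s n = _
  unfold cycC; split_ifs <;> first | rfl | omega

theorem valC1e (s n : ℕ) (h : 1 ≤ s ∧ 4 * s + 2 ≤ n ∧ n ≤ 6 * s + 1 ∧ n % 2 = 0 := by omega) :
    cyc s 1 0 n = (2, 6 * s + 1 - n / 2) := by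
  change cycC s n = _
  unfold cycC; split_ifs <;> first | rfl | omega

theorem valC1o (s n : ℕ) (h : 1 ≤ s ∧ 4 * s + 2 ≤ n ∧ n ≤ 6 * s + 1 ∧ n % 2 = 1 := by omega) :
    cyc s 1 0 n = (2, n / 2 - 2 * s - 1) := by
  change cycC s n = _
  unfold cycC; split_ifs <;> first | rfl | omega

theorem valC2 (s n : ℕ) (h : 1 ≤ s ∧ n = 6 * s + 2 := by omega) :
    cyc s 1 0 n = (4, 0) := by
  change cycC s n = _
  unfold cycC; split_ifs <;> first | rfl | omega

theorem valC3e (s n : ℕ) (h : 1 ≤ s ∧ 6 * s + 3 ≤ n ∧ n ≤ 8 * s + 1 ∧ n % 2 = 0 := by omega) :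
    cyc s 1 0 n = (1, 4 * s + 1 - n / 2) := by
  change cycC s n = _
  unfold cycC; split_ifs <;> first | rfl | omega

theorem valC3o (s n : ℕ) (h : 1 ≤ s ∧ 6 * s + 3 ≤ n ∧ n ≤ 8 * s + 1 ∧ n % 2 = 1 := by omega) :
    cyc s 1 0 n = (1, n / 2 - 2 * s) := by
  change cycC s n = _
  unfold cycC; split_ifs <;> first | rfl | omega

theorem valC4 (s n : ℕ) (h : 1 ≤ s ∧ n = 8 * s + 2 := by omega) :
    cyc s 1 0 n = (1, 4 * s + 1) := by
  change cycC s n = _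
  unfold cycC; split_ifs <;> first | rfl | omega

theorem valD0 (s n : ℕ) (h : 1 ≤ s ∧ n = 0 := by omega) :
    cyc s 1 1 n = (2, s) := by
  change cycD s n = _
  unfold cycD; split_ifs <;> first | rfl | omega

theorem valD1e (s n : ℕ) (h : 1 ≤ s ∧ 1 ≤ n ∧ n ≤ 4 * s - 1 ∧ n % 2 = 0 := by omega) :
    cyc s 1 1 n = (3, 2 * s - 1 - n / 2) := by
  change cycD s n = _
  unfold cycD; split_ifs <;> first | rfl | omega

theorem valD1o (s n : ℕ) (h : 1 ≤ s ∧ 1 ≤ n ∧ n ≤ 4 * s - 1 ∧ n % 2 = 1 := by omega) :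
    cyc s 1 1 n = (0, n / 2 + 3 * s + 2) := by
  change cycD s n = _
  unfold cycD; split_ifs <;> first | rfl | omega

theorem valD2 (s n : ℕ) (h : 1 ≤ s ∧ n = 4 * s := by omega) :
    cyc s 1 1 n = (2, 3 * s) := by
  change cycD s n = _
  unfold cycD; split_ifs <;> first | rfl | omega

theorem valD3 (s n : ℕ) (h : 1 ≤ s ∧ n = 4 * s + 1 := by omega) :
    cyc s 1 1 n = (1, s) := by
  change cycD s n = _
  unfold cycD; split_ifs <;> first | rfl | omega

theorem valD4 (s n : ℕ) (h : 1 ≤ s ∧ n = 4 * s + 2 := by omega) :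
    cyc s 1 1 n = (0, 3 * s + 1) := by
  change cycD s n = _
  unfold cycD; split_ifs <;> first | rfl | omega

theorem valD5e (s n : ℕ) (h : 1 ≤ s ∧ 4 * s + 3 ≤ n ∧ n ≤ 8 * s + 1 ∧ n % 2 = 0 := by omega) :
    cyc s 1 1 n = (2, 5 * s + 1 - n / 2) := by
  change cycD s n = _
  unfold cycD; split_ifs <;> first | rfl | omega

theorem valD5o (s n : ℕ) (h : 1 ≤ s ∧ 4 * s + 3 ≤ n ∧ n ≤ 8 * s + 1 ∧ n % 2 = 1 := by omega) :
    cyc s 1 1 n = (0, n / 2 - s) := by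
  change cycD s n = _
  unfold cycD; split_ifs <;> first | rfl | omega

theorem valD6 (s n : ℕ) (h : 1 ≤ s ∧ n = 8 * s + 2 := by omega) :
    cyc s 1 1 n = (2, s) := by
  change cycD s n = _
  unfold cycD; split_ifs <;> first | rfl | omega

theorem cov00 (s d : ℕ) (hs : 1 ≤ s) (hd0 : 0 < d) (hd : d ≤ 2 * s) :
    Cov s 0 0 d := by
  have key : d = 1 ∨ 2 ≤ d ∧ d + 1 ≤ 2 * s ∨ d = 2 * s := by omega
  rcases key with key | key | key
  · exact cov_mk_rev (valB0 s (0)) (valB1o s (0 + 1))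
  · obtain ⟨n, hn⟩ : ∃ n, n = 6 * s + 1 - d := ⟨_, rfl⟩
    rcases Nat.mod_two_eq_zero_or_one n with hp | hp
    · exact cov_mk_rev (valB3e s n) (valB3o s (n + 1))
    · exact cov_mk (valB3o s n) (valB3e s (n + 1))
  · exact cov_mk_rev (valD4 s (4 * s + 2)) (valD5o s (4 * s + 2 + 1))

theorem cov01 (s d : ℕ) (hs : 1 ≤ s) (hd : d < 4 * s + 1) :
    Cov s 0 1 d := by
  have key : d + 1 ≤ 2 * s ∨ d = 2 * s ∨ d = 2 * s + 1 ∨ 2 * s + 2 ≤ d := by omega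
  rcases key with key | key | key | key
  · obtain ⟨n, hn⟩ : ∃ n, n = d + 2 * s := ⟨_, rfl⟩
    rcases Nat.mod_two_eq_zero_or_one n with hp | hp
    · exact cov_mk_rev (valB1e s n) (valB1o s (n + 1))
    · exact cov_mk (valB1o s n) (valB1e s (n + 1))
  · exact cov_mk_rev (valD3 s (4 * s + 1)) (valD4 s (4 * s + 1 + 1))
  · exact cov_mk_rev (valB2 s (4 * s + 1)) (valB3e s (4 * s + 1 + 1))
  · obtain ⟨n, hn⟩ : ∃ n, n = d - 2 * s - 1 := ⟨_, rfl⟩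
    rcases Nat.mod_two_eq_zero_or_one n with hp | hp
    · exact cov_mk_rev (valB1e s n) (valB1o s (n + 1))
    · exact cov_mk (valB1o s n) (valB1e s (n + 1))

theorem cov02 (s d : ℕ) (hs : 1 ≤ s) (hd : d < 4 * s + 1) :
    Cov s 0 2 d := by
  have key : d + 2 ≤ 2 * s ∨ d + 1 = 2 * s ∨ d = 2 * s ∨ d = 2 * s + 1 ∨ 2 * s + 2 ≤ d := by omega
  rcases key with key | key | key | key | key
  · obtain ⟨n, hn⟩ : ∃ n, n = 6 * s + 1 - d := ⟨_, rfl⟩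
    rcases Nat.mod_two_eq_zero_or_one n with hp | hp
    · exact cov_mk_rev (valD5e s n) (valD5o s (n + 1))
    · exact cov_mk (valD5o s n) (valD5e s (n + 1))
  · exact cov_mk_rev (valD0 s (0)) (valD1o s (0 + 1))
  · exact cov_mk (valD1o s (4 * s - 1)) (valD2 s (4 * s - 1 + 1))
  · exact cov_mk (valD5o s (8 * s + 1)) (valD6 s (8 * s + 1 + 1))
  · obtain ⟨n, hn⟩ : ∃ n, n = 10 * s + 2 - d := ⟨_, rfl⟩
    rcases Nat.mod_two_eq_zero_or_one n with hp | hp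
    · exact cov_mk_rev (valD5e s n) (valD5o s (n + 1))
    · exact cov_mk (valD5o s n) (valD5e s (n + 1))

theorem cov03 (s d : ℕ) (hs : 1 ≤ s) (hd : d < 4 * s + 1)
    (h1 : d + 2 ≠ 3 * s) (h2 : d + 1 ≠ 3 * s) :
    Cov s 0 3 d := by
  have key : d + 3 ≤ 3 * s ∨ d = 3 * s ∨ 3 * s + 1 ≤ d := by omega
  rcases key with key | key | key
  · obtain ⟨n, hn⟩ : ∃ n, n = 3 * s - 2 - d := ⟨_, rfl⟩
    rcases Nat.mod_two_eq_zero_or_one n with hp | hp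
    · exact cov_mk_rev (valD1e s n) (valD1o s (n + 1))
    · exact cov_mk (valD1o s n) (valD1e s (n + 1))
  · exact cov_mk (valB3e s (6 * s)) (valB4o s (6 * s + 1))
  · obtain ⟨n, hn⟩ : ∃ n, n = 7 * s - 1 - d := ⟨_, rfl⟩
    rcases Nat.mod_two_eq_zero_or_one n with hp | hp
    · exact cov_mk_rev (valD1e s n) (valD1o s (n + 1))
    · exact cov_mk (valD1o s n) (valD1e s (n + 1))

theorem covInf0 (s : ℕ) (hs : 1 ≤ s) : CovInf s 0 :=
  covInf_mk_rev (valB5 s (8 * s + 1)) (valB6 s (8 * s + 1 + 1))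

theorem cov11 (s d : ℕ) (hs : 1 ≤ s) (hd0 : 0 < d) (hd : d ≤ 2 * s) :
    Cov s 1 1 d := by
  have key : d = 1 ∨ 2 ≤ d ∧ d + 1 ≤ 2 * s ∨ d = 2 * s := by omega
  rcases key with key | key | key
  · exact cov_mk (valB1e s (4 * s)) (valB2 s (4 * s + 1))
  · obtain ⟨n, hn⟩ : ∃ n, n = d + 6 * s + 1 := ⟨_, rfl⟩
    rcases Nat.mod_two_eq_zero_or_one n with hp | hp
    · exact cov_mk (valC3e s n) (valC3o s (n + 1))
    · exact cov_mk_rev (valC3o s n) (valC3e s (n + 1))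
  · exact cov_mk_rev (valC3o s (8 * s + 1)) (valC4 s (8 * s + 1 + 1))

theorem cov12 (s d : ℕ) (hs : 1 ≤ s) (hd : d < 4 * s + 1) :
    Cov s 1 2 d := by
  have key : d + 1 ≤ 2 * s ∨ d = 2 * s ∨ 2 * s + 1 ≤ d := by omega
  rcases key with key | key | key
  · obtain ⟨n, hn⟩ : ∃ n, n = d + 2 * s := ⟨_, rfl⟩
    rcases Nat.mod_two_eq_zero_or_one n with hp | hp
    · exact cov_mk_rev (valA0e s n) (valA0o s (n + 1))
    · exact cov_mk (valA0o s n) (valA0e s (n + 1))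
  · exact cov_mk_rev (valD2 s (4 * s)) (valD3 s (4 * s + 1))
  · obtain ⟨n, hn⟩ : ∃ n, n = d - 2 * s - 1 := ⟨_, rfl⟩
    rcases Nat.mod_two_eq_zero_or_one n with hp | hp
    · exact cov_mk_rev (valA0e s n) (valA0o s (n + 1))
    · exact cov_mk (valA0o s n) (valA0e s (n + 1))

theorem cov13 (s d : ℕ) (hs : 1 ≤ s) (hd : d < 4 * s + 1) :
    Cov s 1 3 d := by
  have key : d + 1 ≤ 2 * s ∨ 2 * s ≤ d := by omega
  rcases key with key | key
  · obtain ⟨n, hn⟩ : ∃ n, n = d + 2 * s + 1 := ⟨_, rfl⟩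
    rcases Nat.mod_two_eq_zero_or_one n with hp | hp
    · exact cov_mk (valC0e s n) (valC0o s (n + 1))
    · exact cov_mk_rev (valC0o s n) (valC0e s (n + 1))
  · obtain ⟨n, hn⟩ : ∃ n, n = d - 2 * s := ⟨_, rfl⟩
    rcases Nat.mod_two_eq_zero_or_one n with hp | hp
    · exact cov_mk (valC0e s n) (valC0o s (n + 1))
    · exact cov_mk_rev (valC0o s n) (valC0e s (n + 1))

theorem covInf1 (s : ℕ) (hs : 1 ≤ s) : CovInf s 1 :=
  covInf_mk_rev (valC2 s (6 * s + 2)) (valC3o s (6 * s + 2 + 1))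

theorem cov22 (s d : ℕ) (hs : 1 ≤ s) (hd0 : 0 < d) (hd : d ≤ 2 * s) :
    Cov s 2 2 d := by
  have key : d + 1 ≤ 2 * s ∨ d = 2 * s := by omega
  rcases key with key | key
  · obtain ⟨n, hn⟩ : ∃ n, n = d + 4 * s + 1 := ⟨_, rfl⟩
    rcases Nat.mod_two_eq_zero_or_one n with hp | hp
    · exact cov_mk (valC1e s n) (valC1o s (n + 1))
    · exact cov_mk_rev (valC1o s n) (valC1e s (n + 1))
  · exact cov_mk (valA2o s (8 * s + 1)) (valA3 s (8 * s + 1 + 1))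

theorem cov23 (s d : ℕ) (hs : 1 ≤ s) (hd : d < 4 * s + 1) :
    Cov s 2 3 d := by
  have key : d = 0 ∨ d = 1 ∨ 2 ≤ d := by omega
  rcases key with key | key | key
  · exact cov_mk_rev (valC0o s (4 * s + 1)) (valC1e s (4 * s + 1 + 1))
  · exact cov_mk (valA0e s (4 * s)) (valA1 s (4 * s + 1))
  · obtain ⟨n, hn⟩ : ∃ n, n = d + 4 * s := ⟨_, rfl⟩
    rcases Nat.mod_two_eq_zero_or_one n with hp | hp
    · exact cov_mk_rev (valA2e s n) (valA2o s (n + 1))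
    · exact cov_mk (valA2o s n) (valA2e s (n + 1))

theorem covInf2 (s : ℕ) (hs : 1 ≤ s) : CovInf s 2 :=
  covInf_mk (valC1o s (6 * s + 1)) (valC2 s (6 * s + 1 + 1))

theorem cov33 (s d : ℕ) (hs : 1 ≤ s) (hd0 : 0 < d) (hd : d ≤ 2 * s) :
    Cov s 3 3 d := by
  have key : d + 1 ≤ 2 * s ∨ d = 2 * s := by omega
  rcases key with key | key
  · obtain ⟨n, hn⟩ : ∃ n, n = 8 * s - d := ⟨_, rfl⟩
    rcases Nat.mod_two_eq_zero_or_one n with hp | hp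
    · exact cov_mk (valB4e s n) (valB4o s (n + 1))
    · exact cov_mk_rev (valB4o s n) (valB4e s (n + 1))
  · exact cov_mk_rev (valA1 s (4 * s + 1)) (valA2e s (4 * s + 1 + 1))

theorem covInf3 (s : ℕ) (hs : 1 ≤ s) : CovInf s 3 :=
  covInf_mk (valB4e s (8 * s)) (valB5 s (8 * s + 1))

theorem vert00 (s x : ℕ) (hs : 1 ≤ s) (hx : x < 4 * s + 1) (h1 : x ≠ s) :
    Vert s 0 0 x := by
  have key : x = 0 ∨ 1 ≤ x ∧ x + 1 ≤ s ∨ s + 1 ≤ x ∧ x ≤ 2 * s ∨ 2 * s + 1 ≤ x := by omega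
  rcases key with key | key | key | key
  · exact vert_mk (valB0 s (0))
  · exact vert_mk (valB3o s (2 * x + 4 * s + 1))
  · exact vert_mk (valB3e s (8 * s + 2 - 2 * x))
  · exact vert_mk (valB1o s (8 * s + 1 - 2 * x))

theorem vert01 (s x : ℕ) (hs : 1 ≤ s) (hx : x < 4 * s + 1) :
    Vert s 0 1 x := by
  have key : x = 0 ∨ 1 ≤ x ∧ x ≤ 2 * s ∨ 2 * s + 1 ≤ x := by omega
  rcases key with key | key | key
  · exact vert_mk (valB2 s (4 * s + 1))
  · exact vert_mk (valA0o s (4 * s + 1 - 2 * x))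
  · exact vert_mk (valB1e s (2 * x - 4 * s))

theorem vert02 (s x : ℕ) (hs : 1 ≤ s) (hx : x < 4 * s + 1) :
    Vert s 0 2 x := by
  have key : x ≤ 2 * s ∨ 2 * s + 1 ≤ x := by omega
  rcases key with key | key
  · exact vert_mk (valA0e s (2 * x))
  · exact vert_mk (valA2o s (12 * s + 3 - 2 * x))

theorem vert03 (s x : ℕ) (hs : 1 ≤ s) (hx : x < 4 * s + 1) :
    Vert s 0 3 x := by
  have key : x = 0 ∨ 1 ≤ x ∧ x ≤ 2 * s ∨ x = 2 * s + 1 ∨ 2 * s + 2 ≤ x ∧ x ≤ 3 * s + 1 ∨ 3 * s + 2 ≤ x := by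
    omega
  rcases key with key | key | key | key | key
  · exact vert_mk (valB4o s (6 * s + 1))
  · exact vert_mk (valA2e s (2 * x + 4 * s))
  · exact vert_mk (valA1 s (4 * s + 1))
  · exact vert_mk (valB4e s (2 * x + 2 * s - 2))
  · exact vert_mk (valB4o s (14 * s + 3 - 2 * x))

theorem vert04 (s x : ℕ) (hs : 1 ≤ s) (hx : x = 0) :
    Vert s 0 4 x := by
  exact vert_mk (valB5 s (8 * s + 1))

theorem vert10 (s x : ℕ) (hs : 1 ≤ s) (hx : x < 4 * s + 1) :
    Vert s 1 0 x := by
  have key : x ≤ s ∨ s + 1 ≤ x ∧ x ≤ 3 * s ∨ x = 3 * s + 1 ∨ 3 * s + 2 ≤ x := by omega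
  rcases key with key | key | key | key
  · exact vert_mk (valD1o s (2 * x + 2 * s - 1))
  · exact vert_mk (valD5o s (2 * x + 2 * s + 1))
  · exact vert_mk (valD4 s (4 * s + 2))
  · exact vert_mk (valD1o s (2 * x - 6 * s - 3))

theorem vert11 (s x : ℕ) (hs : 1 ≤ s) (hx : x < 4 * s + 1) :
    Vert s 1 1 x := by
  have key : x = 0 ∨ 1 ≤ x ∧ x + 1 ≤ s ∨ x = s ∨ s + 1 ≤ x ∧ x ≤ 2 * s ∨ 2 * s + 1 ≤ x := by omega
  rcases key with key | key | key | key | key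
  · exact vert_mk (valC0e s (0))
  · exact vert_mk (valC3e s (8 * s + 2 - 2 * x))
  · exact vert_mk (valD3 s (4 * s + 1))
  · exact vert_mk (valC3o s (2 * x + 4 * s + 1))
  · exact vert_mk (valC0e s (8 * s + 2 - 2 * x))

theorem vert12 (s x : ℕ) (hs : 1 ≤ s) (hx : x < 4 * s + 1) :
    Vert s 1 2 x := by
  have key : x + 1 ≤ s ∨ x = s ∨ s + 1 ≤ x ∧ x + 1 ≤ 3 * s ∨ x = 3 * s ∨ 3 * s + 1 ≤ x := by omega
  rcases key with key | key | key | key | key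
  · exact vert_mk (valC1o s (2 * x + 4 * s + 3))
  · exact vert_mk (valD0 s (0))
  · exact vert_mk (valD5e s (10 * s + 2 - 2 * x))
  · exact vert_mk (valD2 s (4 * s))
  · exact vert_mk (valC1e s (12 * s + 2 - 2 * x))

theorem vert13 (s x : ℕ) (hs : 1 ≤ s) (hx : x < 4 * s + 1) (h1 : x + 1 ≠ 2 * s) :
    Vert s 1 3 x := by
  have key : x + 2 ≤ 2 * s ∨ 2 * s ≤ x := by omega
  rcases key with key | key
  · exact vert_mk (valD1e s (4 * s - 2 - 2 * x))
  · exact vert_mk (valC0o s (2 * x + 1 - 4 * s))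

theorem vert14 (s x : ℕ) (hs : 1 ≤ s) (hx : x = 0) :
    Vert s 1 4 x := by
  exact vert_mk (valC2 s (6 * s + 2))

/-- A covering of all edges of the complete graph on `2 * k + 1` points by the right number of
`k`-cycles is automatically an almost resolvable cycle system. -/
theorem hasARCS_of_cover {V I : Type} [Fintype V] [Fintype I] (k : ℕ) (hk : 2 ≤ k)
    (hV : Fintype.card V = 2 * k + 1) (hI : Fintype.card I = k)
    (apc : I → Fin 2 → ZMod k → V) (hpc : ZMod k → V)
    (hinj : ∀ i, Function.Injective (fun p : Fin 2 × ZMod k => apc i p.1 p.2))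
    (hinjH : Function.Injective hpc)
    (hcov : ∀ u v : V, u ≠ v →
      (∃ i j z, s(u, v) = s(apc i j z, apc i j (z + 1))) ∨
      ∃ z, s(u, v) = s(hpc z, hpc (z + 1))) :
    HasARCS k (2 * k + 1) := by
  classical
  have : NeZero k := ⟨by omega⟩
  have : Fact (1 < k) := ⟨by omega⟩
  have e1 : (2 * k + 1 - 1) / 2 = k := by omega
  have e2 : (2 * k + 1 - 1) / k = 2 := by
    rw [Nat.add_sub_cancel]; exact Nat.mul_div_cancel _ (by omega)
  have e3 : (2 * k + 1 - 1) / (2 * k) = 1 := by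
    rw [Nat.add_sub_cancel]; exact Nat.div_self (by omega)
  unfold HasARCS
  rw [e1, e2, e3]
  let eV : V ≃ Fin (2 * k + 1) := Fintype.equivFinOfCardEq hV
  let eI : Fin k ≃ I := (Fintype.equivFinOfCardEq hI).symm
  have hne : ∀ z : ZMod k, z ≠ z + 1 := by
    intro z hz
    have : (1 : ZMod k) = 0 := by
      have := hz.symm
      rwa [add_eq_left] at this
    exact one_ne_zero this
  -- the counting argument
  let F : ((I × Fin 2) ⊕ Fin 1) × ZMod k → {e : Sym2 V // ¬ e.IsDiag} := fun q =>
    match q with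
    | (Sum.inl p, z) => ⟨s(apc p.1 p.2 z, apc p.1 p.2 (z + 1)), by
        rw [Sym2.mk_isDiag_iff]
        intro h
        have := @hinj p.1 (p.2, z) (p.2, z + 1) h
        exact hne z (Prod.ext_iff.1 this).2⟩
    | (Sum.inr _, z) => ⟨s(hpc z, hpc (z + 1)), by
        rw [Sym2.mk_isDiag_iff]
        intro h
        exact hne z (hinjH h)⟩
  have hFs : Function.Surjective F := by
    rintro ⟨e, he⟩
    induction e using Sym2.ind with
    | _ u v =>
      rw [Sym2.mk_isDiag_iff] at he
      rcases hcov u v he with ⟨i, j, z, h⟩ | ⟨z, h⟩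
      · exact ⟨(Sum.inl (i, j), z), Subtype.ext h.symm⟩
      · exact ⟨(Sum.inr 0, z), Subtype.ext h.symm⟩
  have hcard : Fintype.card (((I × Fin 2) ⊕ Fin 1) × ZMod k)
      = Fintype.card {e : Sym2 V // ¬ e.IsDiag} := by
    rw [Sym2.card_subtype_not_diag, hV, Nat.choose_two_right]
    simp only [Fintype.card_prod, Fintype.card_sum, Fintype.card_fin, hI, ZMod.card]
    rw [Nat.add_sub_cancel]
    symm
    apply Nat.div_eq_of_eq_mul_left (by norm_num)
    ring
  have hFi : Function.Injective F :=
    ((Fintype.bijective_iff_surjective_and_card F).2 ⟨hFs, hcard⟩).1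
  refine ⟨fun i j z => eV (apc (eI i) j z), fun _ z => eV (hpc z), ?_, ?_, ?_, ?_, ?_⟩
  · intro i j a b h
    have := @hinj (eI i) (j, a) (j, b) (eV.injective h)
    exact (Prod.ext_iff.1 this).2
  · intro _ a b h
    exact hinjH (eV.injective h)
  · intro i j₁ j₂ hj
    rw [Set.disjoint_left]
    rintro _ ⟨a, rfl⟩ ⟨b, h⟩
    have := @hinj (eI i) (j₂, b) (j₁, a) (eV.injective h)
    exact hj (Prod.ext_iff.1 this).1.symm
  · intro j₁ j₂ hj
    exact absurd (Subsingleton.elim j₁ j₂) hj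
  · intro e he
    -- translate to membership in an edge of `F`
    let T : (Fin k × Fin 2) ⊕ Fin 1 → (I × Fin 2) ⊕ Fin 1 :=
      Sum.map (Prod.map eI id) id
    have hT : Function.Injective T :=
      Sum.map_injective.2 ⟨eI.injective.prodMap Function.injective_id, Function.injective_id⟩
    have hTs : Function.Surjective T :=
      Sum.map_surjective.2 ⟨eI.surjective.prodMap Function.surjective_id,
        Function.surjective_id⟩
    have key : ∀ p, e ∈ Sum.elim
        (fun q : Fin k × Fin 2 => cycleEdgeSet (fun z => eV (apc (eI q.1) q.2 z)))
        (fun _ : Fin 1 => cycleEdgeSet (fun z => eV (hpc z))) p ↔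
        ∃ z, e = Sym2.map eV (F (T p, z)).1 := by
      rintro (p | p) <;> exact Iff.rfl
    have hmap : Function.Injective (Sym2.map eV) := Sym2.map.injective eV.injective
    obtain ⟨u, v, rfl⟩ : ∃ u v, e = s(eV u, eV v) := by
      induction e using Sym2.ind with
      | _ u v => exact ⟨eV.symm u, eV.symm v, by simp⟩
    have huv : ¬ (s(u, v)).IsDiag := by
      rw [Sym2.mk_isDiag_iff] at he ⊢
      exact fun h => he (congrArg eV h)
    obtain ⟨⟨r, z⟩, hr⟩ := hFs ⟨s(u, v), huv⟩
    obtain ⟨p, rfl⟩ := hTs r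
    refine ⟨p, (key p).2 ⟨z, ?_⟩, ?_⟩
    · rw [hr]; rfl
    · intro p₂ hp₂
      obtain ⟨z₂, hz₂⟩ := (key p₂).1 hp₂
      have h2 : (F (T p₂, z₂)).1 = s(u, v) := by
        apply hmap
        rw [← hz₂]; rfl
      have h3 : F (T p₂, z₂) = F (T p, z) := by
        rw [hr]; exact Subtype.ext h2
      exact hT (Prod.ext_iff.1 (hFi h3)).1

/-- Interpretation of a pair (orbit, coordinate) as a vertex. -/
def toV (s : ℕ) (p : ℕ × ℕ) : Option (Fin 4 × ZMod (4 * s + 1)) :=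
  if h : p.1 < 4 then some (⟨p.1, h⟩, (p.2 : ZMod (4 * s + 1))) else none

/-- Translation by `r`. -/
def sh (s : ℕ) (r : ZMod (4 * s + 1)) :
    Option (Fin 4 × ZMod (4 * s + 1)) → Option (Fin 4 × ZMod (4 * s + 1)) :=
  Option.map (fun q => (q.1, q.2 + r))

theorem sh_injective (s : ℕ) (r : ZMod (4 * s + 1)) : Function.Injective (sh s r) := by
  apply Option.map_injective
  rintro ⟨a, b⟩ ⟨c, d⟩ h
  simpa using h

theorem cast_mod (s : ℕ) : (4 * (s : ZMod (4 * s + 1)) + 1) = 0 := by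
  have := ZMod.natCast_self (4 * s + 1)
  push_cast at this
  exact this

theorem toV_lt (s : ℕ) {i : ℕ} (hi : i < 4) {p : ℕ × ℕ} (h : p.1 = i) :
    toV s p = some (⟨i, hi⟩, (p.2 : ZMod (4 * s + 1))) := by
  subst h
  exact dif_pos hi

theorem toV_four (s : ℕ) {p : ℕ × ℕ} (h : p.1 = 4) : toV s p = none := by
  apply dif_neg
  omega

/-- The vertex missed by the class `h`. -/
def missed (s : ℕ) (h : Fin 2) : ℕ × ℕ := if h = 0 then (0, s) else (3, 2 * s - 1)

theorem vert_all (s : ℕ) (hs : 1 ≤ s) (h : Fin 2) (i x : ℕ) (hi : i < 4) (hx : x < 4 * s + 1)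
    (hm : (i, x) ≠ missed s h) : Vert s h i x := by
  unfold missed at hm
  fin_cases h
  · simp only [Fin.zero_eta, Fin.isValue, if_true, ne_eq, Prod.mk.injEq, not_and] at hm
    interval_cases i
    · exact vert00 s x hs hx (hm rfl)
    · exact vert01 s x hs hx
    · exact vert02 s x hs hx
    · exact vert03 s x hs hx
  · simp only [Fin.mk_one, Fin.isValue, one_ne_zero, if_false, ne_eq, Prod.mk.injEq,
      not_and] at hm
    interval_cases i
    · exact vert10 s x hs hx
    · exact vert11 s x hs hx
    · exact vert12 s x hs hx
    · exact vert13 s x hs hx (by have := hm rfl; omega)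

theorem cover_vertices (s : ℕ) (hs : 1 ≤ s) (h : Fin 2)
    (v : Option (Fin 4 × ZMod (4 * s + 1))) (hv : v ≠ toV s (missed s h)) :
    ∃ (l : Fin 2) (n : ℕ), n < 8 * s + 2 ∧ toV s (cyc s h l n) = v := by
  rcases v with _ | ⟨i, x⟩
  · have : Vert s h 4 0 := by
      fin_cases h
      · exact vert04 s 0 hs rfl
      · exact vert14 s 0 hs rfl
    obtain ⟨l, n, hn, h1, -⟩ := this
    exact ⟨l, n, hn, toV_four s h1⟩
  · have hx : ((x.val : ℕ) : ZMod (4 * s + 1)) = x := ZMod.natCast_zmod_val x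
    have hne : ((i : ℕ), x.val) ≠ missed s h := by
      intro e
      apply hv
      rw [← e, toV_lt s i.2 rfl, hx]
    obtain ⟨l, n, hn, h1, h2⟩ := vert_all s hs h i x.val i.2 (ZMod.val_lt x) hne
    refine ⟨l, n, hn, ?_⟩
    rw [toV_lt s i.2 h1]
    have h3 : (((cyc s h l n).2 : ℕ) : ZMod (4 * s + 1)) = x := by
      rcases h2 with h2 | h2
      · rw [h2, hx]
      · rw [h2, Nat.cast_add, hx, ZMod.natCast_self, add_zero]
    rw [h3]

theorem class_injective (s : ℕ) (hs : 1 ≤ s) (h : Fin 2) : Function.Injective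
    (fun p : Fin 2 × ZMod (8 * s + 2) => toV s (cyc s h p.1 p.2.val)) := by
  classical
  have hsub : (Finset.univ.erase (toV s (missed s h))) ⊆
      Finset.univ.image
        (fun p : Fin 2 × ZMod (8 * s + 2) => toV s (cyc s h p.1 p.2.val)) := by
    intro v hv
    obtain ⟨l, n, hn, e⟩ := cover_vertices s hs h v (Finset.ne_of_mem_erase hv)
    refine Finset.mem_image.2 ⟨(l, (n : ZMod (8 * s + 2))), Finset.mem_univ _, ?_⟩
    simp only [ZMod.val_natCast_of_lt hn, e]
  have h1 := Finset.card_le_card hsub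
  rw [Finset.card_erase_of_mem (Finset.mem_univ _), Finset.card_univ, Fintype.card_option,
    Fintype.card_prod, ZMod.card, Fintype.card_fin] at h1
  have h2 : (Finset.univ : Finset (Fin 2 × ZMod (8 * s + 2))).card = 2 * (8 * s + 2) := by
    rw [Finset.card_univ, Fintype.card_prod, ZMod.card, Fintype.card_fin]
  have h3 := Finset.card_image_le (s := (Finset.univ : Finset (Fin 2 × ZMod (8 * s + 2))))
    (f := fun p => toV s (cyc s h p.1 p.2.val))
  have h4 : (Finset.univ.image
      (fun p : Fin 2 × ZMod (8 * s + 2) => toV s (cyc s h p.1 p.2.val))).card =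
      (Finset.univ : Finset (Fin 2 × ZMod (8 * s + 2))).card := by
    omega
  have h5 := Finset.card_image_iff.1 h4
  intro a b hab
  exact h5 (by simp) (by simp) hab

theorem cyc_close (s : ℕ) (hs : 1 ≤ s) (h l : Fin 2) :
    toV s (cyc s h l (8 * s + 2)) = toV s (cyc s h l 0) := by
  fin_cases h <;> fin_cases l
  · exact congrArg _ ((valA3 s (8 * s + 2)).trans (valA0e s 0).symm)
  · exact congrArg _ ((valB6 s (8 * s + 2)).trans (valB0 s 0).symm)
  · exact congrArg _ ((valC4 s (8 * s + 2)).trans (valC0e s 0).symm)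
  · exact congrArg _ ((valD6 s (8 * s + 2)).trans (valD0 s 0).symm)

theorem val_succ (s : ℕ) (hs : 1 ≤ s) (h l : Fin 2) (n : ℕ) (hn : n < 8 * s + 2) :
    toV s (cyc s h l ((n : ZMod (8 * s + 2)) + 1).val) = toV s (cyc s h l (n + 1)) := by
  rcases Nat.lt_or_ge (n + 1) (8 * s + 2) with h1 | h1
  · rw [← Nat.cast_succ, ZMod.val_natCast_of_lt h1]
  · have h2 : n + 1 = 8 * s + 2 := by omega
    have h0 : ((n : ZMod (8 * s + 2)) + 1) = 0 := by
      rw [← Nat.cast_succ, Nat.succ_eq_add_one, h2, ZMod.natCast_self]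
    rw [h0, ZMod.val_zero, h2, cyc_close s hs]

theorem cov_lt (s i j d : ℕ) (hs : 1 ≤ s) (hij : i < j) (hj : j < 4) (hd : d < 4 * s + 1)
    (h1 : i = 0 → j = 3 → d + 2 ≠ 3 * s ∧ d + 1 ≠ 3 * s) : Cov s i j d := by
  interval_cases j <;> interval_cases i
  · exact cov01 s d hs hd
  · exact cov02 s d hs hd
  · exact cov12 s d hs hd
  · exact cov03 s d hs hd (h1 rfl rfl).1 (h1 rfl rfl).2
  · exact cov13 s d hs hd
  · exact cov23 s d hs hd

theorem cov_eq (s i d : ℕ) (hs : 1 ≤ s) (hi : i < 4) (h0 : 0 < d) (hd : d ≤ 2 * s) :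
    Cov s i i d := by
  interval_cases i
  · exact cov00 s d hs h0 hd
  · exact cov11 s d hs h0 hd
  · exact cov22 s d hs h0 hd
  · exact cov33 s d hs h0 hd

theorem covInf_all (s i : ℕ) (hs : 1 ≤ s) (hi : i < 4) : CovInf s i := by
  interval_cases i
  · exact covInf0 s hs
  · exact covInf1 s hs
  · exact covInf2 s hs
  · exact covInf3 s hs

/-- The developed cycles. -/
def apc (s : ℕ) (i : ZMod (4 * s + 1) × Fin 2) (l : Fin 2) (z : ZMod (8 * s + 2)) :
    Option (Fin 4 × ZMod (4 * s + 1)) := sh s i.1 (toV s (cyc s i.2 l z.val))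

/-- The half-parallel class. -/
def hpcN (s n : ℕ) : Option (Fin 4 × ZMod (4 * s + 1)) :=
  if n % 2 = 0 then some (0, ((n / 2 : ℕ) : ZMod (4 * s + 1)))
  else some (3, ((n / 2 + (3 * s - 1) : ℕ) : ZMod (4 * s + 1)))

theorem natCast_inj_of_lt {m a b : ℕ} (ha : a < m) (hb : b < m)
    (h : (a : ZMod m) = (b : ZMod m)) : a = b := by
  rw [ZMod.natCast_eq_natCast_iff'] at h
  rwa [Nat.mod_eq_of_lt ha, Nat.mod_eq_of_lt hb] at h

theorem hpc_injective (s : ℕ) :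
    Function.Injective (fun z : ZMod (8 * s + 2) => hpcN s z.val) := by
  intro a b h
  have ha := ZMod.val_lt a
  have hb := ZMod.val_lt b
  apply ZMod.val_injective
  simp only [hpcN] at h
  split_ifs at h with h1 h2 h2
  · simp only [Option.some.injEq, Prod.mk.injEq, true_and] at h
    have := natCast_inj_of_lt (by omega) (by omega) h
    omega
  · simp at h
  · simp at h
  · simp only [Option.some.injEq, Prod.mk.injEq, true_and, Nat.cast_add, add_left_inj] at h
    have := natCast_inj_of_lt (by omega) (by omega) h
    omega

theorem hpc_succ (s n : ℕ) (hn : n < 8 * s + 2) :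
    hpcN s ((n : ZMod (8 * s + 2)) + 1).val = hpcN s (n + 1) := by
  rcases Nat.lt_or_ge (n + 1) (8 * s + 2) with h1 | h1
  · rw [← Nat.cast_succ, ZMod.val_natCast_of_lt h1]
  · have h2 : n + 1 = 8 * s + 2 := by omega
    have h0 : ((n : ZMod (8 * s + 2)) + 1) = 0 := by
      rw [← Nat.cast_succ, Nat.succ_eq_add_one, h2, ZMod.natCast_self]
    rw [h0, ZMod.val_zero, h2]
    have h3 : (8 * s + 2) % 2 = 0 := by omega
    have h4 : (8 * s + 2) / 2 = 4 * s + 1 := by omega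
    simp only [hpcN, h3, h4, if_true, ZMod.natCast_self]
    simp

/-- The edge `s(u, v)` lies in one of the cycles. -/
def Good (s : ℕ) (u v : Option (Fin 4 × ZMod (4 * s + 1))) : Prop :=
  (∃ i l z, s(u, v) = s(apc s i l z, apc s i l (z + 1))) ∨
    ∃ z : ZMod (8 * s + 2), s(u, v) = s(hpcN s z.val, hpcN s (z + 1).val)

theorem Good.symm {s : ℕ} {u v : Option (Fin 4 × ZMod (4 * s + 1))} (h : Good s u v) :
    Good s v u := by
  unfold Good at *
  rwa [Sym2.eq_swap]

theorem good_of_edge (s : ℕ) (hs : 1 ≤ s) (r : ZMod (4 * s + 1)) (h l : Fin 2) (n : ℕ)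
    (hn : n < 8 * s + 2) :
    Good s (sh s r (toV s (cyc s h l n))) (sh s r (toV s (cyc s h l (n + 1)))) := by
  refine Or.inl ⟨(r, h), l, (n : ZMod (8 * s + 2)), ?_⟩
  simp only [apc, val_succ s hs h l n hn, ZMod.val_natCast_of_lt hn]

theorem good_of_rel (s : ℕ) (i j : Fin 4) (x y : ZMod (4 * s + 1)) (d : ℕ)
    (hd : (d : ZMod (4 * s + 1)) = y - x) (p q : ℕ × ℕ) (h : Rel s i j d p q) :
    ∃ r, sh s r (toV s p) = some (i, x) ∧ sh s r (toV s q) = some (j, y) := by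
  obtain ⟨h1, h2, h3⟩ := h
  have h4 : (q.2 : ZMod (4 * s + 1)) = p.2 + (y - x) := by
    have h0 := ZMod.natCast_self (4 * s + 1)
    rw [← hd, ← Nat.cast_add]
    rcases h3 with h3 | h3 | h3
    · rw [h3]
    · rw [← h3, Nat.cast_add, h0, add_zero]
    · rw [← h3, Nat.cast_add, Nat.cast_mul, h0, mul_zero, add_zero]
  refine ⟨x - p.2, ?_, ?_⟩
  · rw [toV_lt s i.2 h1]
    simp [sh]
  · rw [toV_lt s j.2 h2, h4]
    simp [sh]
    ring

theorem good_of_cov (s : ℕ) (hs : 1 ≤ s) (i j : Fin 4) (x y : ZMod (4 * s + 1)) (d : ℕ)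
    (hd : (d : ZMod (4 * s + 1)) = y - x) (hc : Cov s i j d) :
    Good s (some (i, x)) (some (j, y)) := by
  obtain ⟨h, l, n, hn, hr | hr⟩ := hc
  · obtain ⟨r, h1, h2⟩ := good_of_rel s i j x y d hd _ _ hr
    rw [← h1, ← h2]
    exact good_of_edge s hs r h l n hn
  · obtain ⟨r, h1, h2⟩ := good_of_rel s i j x y d hd _ _ hr
    rw [← h1, ← h2]
    exact (good_of_edge s hs r h l n hn).symm

theorem good_inf (s : ℕ) (hs : 1 ≤ s) (i : Fin 4) (x : ZMod (4 * s + 1)) :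
    Good s (some (i, x)) none := by
  have aux : ∀ p q : ℕ × ℕ, p.1 = i → q.1 = 4 →
      ∃ r, sh s r (toV s p) = some (i, x) ∧ sh s r (toV s q) = none := by
    intro p q h1 h2
    refine ⟨x - p.2, ?_, ?_⟩
    · rw [toV_lt s i.2 h1]
      simp [sh]
    · rw [toV_four s h2]
      rfl
  obtain ⟨h, l, n, hn, ⟨h1, h2⟩ | ⟨h1, h2⟩⟩ := covInf_all s i hs i.2
  · obtain ⟨r, h1, h2⟩ := aux _ _ h1 h2
    rw [← h1, ← h2]
    exact good_of_edge s hs r h l n hn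
  · obtain ⟨r, h1, h2⟩ := aux _ _ h1 h2
    rw [← h1, ← h2]
    exact (good_of_edge s hs r h l n hn).symm

theorem good_hpc (s : ℕ) (x y : ZMod (4 * s + 1)) (d : ℕ)
    (hd : (d : ZMod (4 * s + 1)) = y - x) (h : d + 2 = 3 * s ∨ d + 1 = 3 * s) :
    Good s (some (0, x)) (some (3, y)) := by
  have hy : y = x + d := by rw [hd]; ring
  have hx : ((x.val : ℕ) : ZMod (4 * s + 1)) = x := ZMod.natCast_zmod_val x
  have hlt := ZMod.val_lt x
  rcases h with h | h
  · -- the edge ending in `x`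
    obtain ⟨t, ht, htx⟩ : ∃ t : ℕ, t < 4 * s + 1 ∧ ((t : ZMod (4 * s + 1)) + 1 = x) :=
      ⟨(x - 1).val, ZMod.val_lt _, by rw [ZMod.natCast_zmod_val]; ring⟩
    have hn : 2 * t + 1 < 8 * s + 2 := by omega
    refine Or.inr ⟨((2 * t + 1 : ℕ) : ZMod (8 * s + 2)), ?_⟩
    rw [hpc_succ s _ hn, ZMod.val_natCast_of_lt hn]
    have e1 : (2 * t + 1) % 2 = 1 := by omega
    have e2 : (2 * t + 1) / 2 = t := by omega
    have e3 : (2 * t + 1 + 1) % 2 = 0 := by omega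
    have e4 : (2 * t + 1 + 1) / 2 = t + 1 := by omega
    have e5 : t + (3 * s - 1) = t + 1 + d := by omega
    simp only [hpcN, e1, e2, e3, e4, e5, if_true, one_ne_zero, if_false]
    rw [hy, ← htx, Sym2.eq_swap]
    push_cast
    rfl
  · have hn : 2 * x.val < 8 * s + 2 := by omega
    refine Or.inr ⟨((2 * x.val : ℕ) : ZMod (8 * s + 2)), ?_⟩
    rw [hpc_succ s _ hn, ZMod.val_natCast_of_lt hn]
    have e1 : (2 * x.val) % 2 = 0 := by omega
    have e2 : (2 * x.val) / 2 = x.val := by omega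
    have e3 : (2 * x.val + 1) % 2 = 1 := by omega
    have e4 : (2 * x.val + 1) / 2 = x.val := by omega
    have e5 : 3 * s - 1 = d := by omega
    simp only [hpcN, e1, e2, e3, e4, e5, if_true, one_ne_zero, if_false, Nat.cast_add, hx, hy]

theorem good_lt (s : ℕ) (hs : 1 ≤ s) (i j : Fin 4) (x y : ZMod (4 * s + 1)) (hij : i < j) :
    Good s (some (i, x)) (some (j, y)) := by
  have hd : (((y - x).val : ℕ) : ZMod (4 * s + 1)) = y - x := ZMod.natCast_zmod_val _
  by_cases hc : ((i : ℕ) = 0 ∧ (j : ℕ) = 3) ∧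
      ((y - x).val + 2 = 3 * s ∨ (y - x).val + 1 = 3 * s)
  · obtain ⟨⟨hi, hj⟩, h⟩ := hc
    obtain rfl : i = 0 := Fin.ext hi
    obtain rfl : j = 3 := Fin.ext hj
    exact good_hpc s x y _ hd h
  · refine good_of_cov s hs i j x y _ hd (cov_lt s i j _ hs hij j.2 (ZMod.val_lt _) ?_)
    intro hi hj
    constructor
    · exact fun h => hc ⟨⟨hi, hj⟩, Or.inl h⟩
    · exact fun h => hc ⟨⟨hi, hj⟩, Or.inr h⟩

theorem good_eq (s : ℕ) (hs : 1 ≤ s) (i : Fin 4) (x y : ZMod (4 * s + 1)) (hxy : x ≠ y) :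
    Good s (some (i, x)) (some (i, y)) := by
  have hd : (((y - x).val : ℕ) : ZMod (4 * s + 1)) = y - x := ZMod.natCast_zmod_val _
  have hlt := ZMod.val_lt (y - x)
  have h0 : 0 < (y - x).val := by
    rw [Nat.pos_iff_ne_zero, Ne, ZMod.val_eq_zero, sub_eq_zero]
    exact hxy.symm
  by_cases h : (y - x).val ≤ 2 * s
  · exact good_of_cov s hs i i x y _ hd (cov_eq s i _ hs i.2 h0 h)
  · apply Good.symm
    refine good_of_cov s hs i i y x (4 * s + 1 - (y - x).val) ?_
      (cov_eq s i _ hs i.2 (by omega) (by omega))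
    rw [Nat.cast_sub hlt.le, hd, ZMod.natCast_self]
    ring

theorem good_all (s : ℕ) (hs : 1 ≤ s) (u v : Option (Fin 4 × ZMod (4 * s + 1)))
    (huv : u ≠ v) : Good s u v := by
  rcases u with _ | ⟨i, x⟩ <;> rcases v with _ | ⟨j, y⟩
  · exact absurd rfl huv
  · exact (good_inf s hs j y).symm
  · exact good_inf s hs i x
  · rcases lt_trichotomy i j with h | rfl | h
    · exact good_lt s hs i j x y h
    · exact good_eq s hs i x y (fun e => huv (by rw [e]))
    · exact (good_lt s hs j i y x h).symm

theorem hasARCS_base (s : ℕ) (hs : 1 ≤ s) : HasARCS (8 * s + 2) (2 * (8 * s + 2) + 1) := by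
  refine hasARCS_of_cover (V := Option (Fin 4 × ZMod (4 * s + 1)))
    (I := ZMod (4 * s + 1) × Fin 2) (8 * s + 2) (by omega) ?_ ?_ (apc s)
    (fun z => hpcN s z.val) ?_ (hpc_injective s) (good_all s hs)
  · rw [Fintype.card_option, Fintype.card_prod, ZMod.card, Fintype.card_fin]
    ring
  · rw [Fintype.card_prod, ZMod.card, Fintype.card_fin]
    ring
  · intro i
    exact (sh_injective s i.1).comp (class_injective s hs i.2)

end ARCS

/-- For every `k ≥ 34` with `k ≡ 10 (mod 24)`, there exists an almost resolvable
`k`-cycle system of order `2k+1`. -/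
theorem arcs_mod24_case_10 (k : ℕ) (hk : 34 ≤ k) (hk24 : k % 24 = 10) :
    HasARCS k (2 * k + 1) := by
  obtain ⟨s, hs, rfl⟩ : ∃ s, 1 ≤ s ∧ k = 8 * s + 2 := ⟨(k - 2) / 8, by omega, by omega⟩
  exact ARCS.hasARCS_base s hs
end

section
/- For every k ≥ 42 with k ≡ 18 (mod 24), there exists an almost resolvable k-cycle system of order 2k+1. -/
set_option linter.unusedSimpArgs false
set_option linter.unnecessarySeqFocus false

/-! ### The base cycles and the differences they cover -/

/-- Base cycle `gA1`: layer and position of its `p`-th vertex (layer `4` is the point at infinity). -/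
def gA1 (h p : ℤ) : ℕ × ℤ :=
  if p = 0 then (0, 0)
  else if p = 1 then (0, 2 * h)
  else if p = 2 then (4, 0)
  else if p = 3 then (2, 0)
  else if p = 4 then (0, -2)
  else if p < 4 * h + 1 then (if (p - 5) % 2 = 0 then (2, 1 + (p - 5) / 2) else (0, -3 - (p - 5) / 2))
  else if p < 8 * h + 1 then (if (p - (4 * h + 1)) % 2 = 0 then (1, -3 - (p - (4 * h + 1)) / 2) else (3, 0 + (p - (4 * h + 1)) / 2))
  else (2, -2)

/-- Base cycle `gA2`: layer and position of its `p`-th vertex (layer `4` is the point at infinity). -/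
def gA2 (h p : ℤ) : ℕ × ℤ :=
  if p = 0 then (0, -1)
  else if p = 1 then (3, -1)
  else if p = 2 then (1, -2)
  else if p = 3 then (2, 2 * h - 1)
  else if p < 4 * h + 2 then (if (p - 4) % 2 = 0 then (3, -2 - (p - 4) / 2) else (2, 2 * h + (p - 4) / 2))
  else if p = 4 * h + 2 then (1, 2 * h - 2)
  else if p = 4 * h + 3 then (3, 2 * h)
  else (if (p - (4 * h + 4)) % 2 = 0 then (0, 2 * h - 1 - (p - (4 * h + 4)) / 2) else (1, -1 + (p - (4 * h + 4)) / 2))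

/-- Base cycle `gB1`: layer and position of its `p`-th vertex (layer `4` is the point at infinity). -/
def gB1 (h p : ℤ) : ℕ × ℤ :=
  if p = 0 then (0, 3 * h)
  else if p = 1 then (2, 3 * h)
  else if p = 2 then (0, 3 * h + 1)
  else if p < 2 * h + 2 then (if (p - 3) % 2 = 0 then (0, h - 1 - (p - 3) / 2) else (0, 3 * h + 2 + (p - 3) / 2))
  else if p = 2 * h + 2 then (1, 2 * h - 1)
  else if p < 6 * h + 1 then (if (p - (2 * h + 3)) % 2 = 0 then (2, 0 + (p - (2 * h + 3)) / 2) else (1, 2 * h - 2 - (p - (2 * h + 3)) / 2))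
  else if p = 6 * h + 1 then (2, 2 * h - 1)
  else if p < 8 * h + 1 then (if (p - (6 * h + 2)) % 2 = 0 then (2, 2 * h + (p - (6 * h + 2)) / 2) else (2, -1 - (p - (6 * h + 2)) / 2))
  else (2, 3 * h + 1)

/-- Base cycle `gB2`: layer and position of its `p`-th vertex (layer `4` is the point at infinity). -/
def gB2 (h p : ℤ) : ℕ × ℤ :=
  if p = 0 then (1, 3 * h)
  else if p = 1 then (1, 3 * h + 1)
  else if p < 2 * h + 1 then (if (p - 2) % 2 = 0 then (1, 3 * h - 1 - (p - 2) / 2) else (1, 3 * h + 2 + (p - 2) / 2))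
  else if p = 2 * h + 1 then (4, 0)
  else if p < 4 * h + 1 then (if (p - (2 * h + 2)) % 2 = 0 then (3, 2 * h - 1 - (p - (2 * h + 2)) / 2) else (3, 2 * h + 1 + (p - (2 * h + 2)) / 2))
  else if p = 4 * h + 1 then (3, 3 * h)
  else (if (p - (4 * h + 2)) % 2 = 0 then (3, 3 * h + 1 + (p - (4 * h + 2)) / 2) else (0, 3 * h - 1 - (p - (4 * h + 2)) / 2))

/-- The four base cycles: `gg h false _` is the first class, `gg h true _` the second one. -/
def gg (h : ℤ) : Bool → Bool → ℤ → ℕ × ℤ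
  | false, false => gA1 h
  | false, true => gA2 h
  | true, false => gB1 h
  | true, true => gB2 h

/-- Vertex `r` of layer `l` is covered by class `X` (positions modulo `4 * h + 1`). -/
def CovV (h : ℤ) (X : Bool) (l : ℕ) (r : ℤ) : Prop :=
  ∃ (j : Bool) (p q : ℤ), (0 ≤ p ∧ p ≤ 8 * h + 1) ∧
    (gg h X j p).1 = l ∧ (gg h X j p).2 = r + q * (4 * h + 1)

/-- The index `pn` is the cyclic successor of `p` among the indices of a cycle. -/
abbrev NextIdx (h p pn : ℤ) : Prop :=
  (0 ≤ p ∧ p ≤ 8 * h + 1) ∧ (pn = p + 1 ∧ p ≤ 8 * h ∨ p = 8 * h + 1 ∧ pn = 0)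

/-- Difference `d` between layers `l` and `l'` occurs on a base cycle. -/
def CovE (h : ℤ) (l l' : ℕ) (d : ℤ) : Prop :=
  ∃ (X j : Bool) (p p' q : ℤ), NextIdx h p p' ∧
    (((gg h X j p).1 = l ∧ (gg h X j p').1 = l' ∧
        (gg h X j p').2 - (gg h X j p).2 = d + q * (4 * h + 1)) ∨
     ((gg h X j p').1 = l ∧ (gg h X j p).1 = l' ∧
        (gg h X j p).2 - (gg h X j p').2 = d + q * (4 * h + 1)))

/-- The infinite point is joined to layer `l` on a base cycle. -/
def CovI (h : ℤ) (l : ℕ) : Prop :=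
  ∃ (X j : Bool) (p p' : ℤ), NextIdx h p p' ∧
    (((gg h X j p).1 = l ∧ (gg h X j p').1 = 4) ∨ ((gg h X j p').1 = l ∧ (gg h X j p).1 = 4))

lemma covV_A0 (h r : ℤ) (hh : 5 ≤ h) (h0 : 0 ≤ r) (h1 : r ≤ 4 * h) :
    CovV h false 0 r := by
  rcases (by omega : r = 0 ∨
      (1 ≤ r ∧ r ≤ 2 * h - 1) ∨
      r = 2 * h ∨
      (2 * h + 1 ≤ r ∧ r ≤ 4 * h - 2) ∨
      r = 4 * h - 1 ∨
      r = 4 * h) with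
    hr | hr | hr | hr | hr | hr <;> [
    refine ⟨false, 0, 0, ?_⟩;
    refine ⟨true, 4 * h + 4 + 2 * (2 * h - 1 - (r)), 0, ?_⟩;
    refine ⟨false, 1, 0, ?_⟩;
    refine ⟨false, 6 + 2 * (-3 - (r + (-1) * (4 * h + 1))), -1, ?_⟩;
    refine ⟨false, 4, -1, ?_⟩;
    refine ⟨true, 0, -1, ?_⟩]
  all_goals refine ⟨by omega, ?_⟩
  all_goals simp (disch := omega) only [gg, gA1, gA2, ↓reduceIte, if_pos, if_neg, true_and] <;> omega

lemma covV_A1 (h r : ℤ) (hh : 5 ≤ h) (h0 : 0 ≤ r) (h1 : r ≤ 4 * h) :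
    CovV h false 1 r := by
  rcases (by omega : (0 ≤ r ∧ r ≤ 2 * h - 3) ∨
      r = 2 * h - 2 ∨
      (2 * h - 1 ≤ r ∧ r ≤ 4 * h - 2) ∨
      r = 4 * h - 1 ∨
      r = 4 * h) with
    hr | hr | hr | hr | hr <;> [
    refine ⟨true, 4 * h + 5 + 2 * (r - (-1)), 0, ?_⟩;
    refine ⟨true, 4 * h + 2, 0, ?_⟩;
    refine ⟨false, 4 * h + 1 + 2 * (-3 - (r + (-1) * (4 * h + 1))), -1, ?_⟩;
    refine ⟨true, 2, -1, ?_⟩;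
    refine ⟨true, 4 * h + 5 + 2 * (r + (-1) * (4 * h + 1) - (-1)), -1, ?_⟩]
  all_goals refine ⟨by omega, ?_⟩
  all_goals simp (disch := omega) only [gg, gA1, gA2, ↓reduceIte, if_pos, if_neg, true_and] <;> omega

lemma covV_A2 (h r : ℤ) (hh : 5 ≤ h) (h0 : 0 ≤ r) (h1 : r ≤ 4 * h) (hm : r ≠ 4 * h) :
    CovV h false 2 r := by
  rcases (by omega : r = 0 ∨
      (1 ≤ r ∧ r ≤ 2 * h - 2) ∨
      r = 2 * h - 1 ∨
      (2 * h ≤ r ∧ r ≤ 4 * h - 2) ∨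
      r = 4 * h - 1) with
    hr | hr | hr | hr | hr <;> [
    refine ⟨false, 3, 0, ?_⟩;
    refine ⟨false, 5 + 2 * (r - (1)), 0, ?_⟩;
    refine ⟨true, 3, 0, ?_⟩;
    refine ⟨true, 5 + 2 * (r - (2 * h)), 0, ?_⟩;
    refine ⟨false, 8 * h + 1, -1, ?_⟩]
  all_goals refine ⟨by omega, ?_⟩
  all_goals simp (disch := omega) only [gg, gA1, gA2, ↓reduceIte, if_pos, if_neg, true_and] <;> omega

lemma covV_A3 (h r : ℤ) (hh : 5 ≤ h) (h0 : 0 ≤ r) (h1 : r ≤ 4 * h) :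
    CovV h false 3 r := by
  rcases (by omega : (0 ≤ r ∧ r ≤ 2 * h - 1) ∨
      r = 2 * h ∨
      (2 * h + 1 ≤ r ∧ r ≤ 4 * h - 1) ∨
      r = 4 * h) with
    hr | hr | hr | hr <;> [
    refine ⟨false, 4 * h + 2 + 2 * (r - (0)), 0, ?_⟩;
    refine ⟨true, 4 * h + 3, 0, ?_⟩;
    refine ⟨true, 4 + 2 * (-2 - (r + (-1) * (4 * h + 1))), -1, ?_⟩;
    refine ⟨true, 1, -1, ?_⟩]
  all_goals refine ⟨by omega, ?_⟩
  all_goals simp (disch := omega) only [gg, gA1, gA2, ↓reduceIte, if_pos, if_neg, true_and] <;> omega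

lemma covV_B0 (h r : ℤ) (hh : 5 ≤ h) (h0 : 0 ≤ r) (h1 : r ≤ 4 * h) :
    CovV h true 0 r := by
  rcases (by omega : (0 ≤ r ∧ r ≤ h - 1) ∨
      (h ≤ r ∧ r ≤ 3 * h - 1) ∨
      r = 3 * h ∨
      r = 3 * h + 1 ∨
      (3 * h + 2 ≤ r ∧ r ≤ 4 * h)) with
    hr | hr | hr | hr | hr <;> [
    refine ⟨false, 3 + 2 * (h - 1 - (r)), 0, ?_⟩;
    refine ⟨true, 4 * h + 3 + 2 * (3 * h - 1 - (r)), 0, ?_⟩;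
    refine ⟨false, 0, 0, ?_⟩;
    refine ⟨false, 2, 0, ?_⟩;
    refine ⟨false, 4 + 2 * (r - (3 * h + 2)), 0, ?_⟩]
  all_goals refine ⟨by omega, ?_⟩
  all_goals simp (disch := omega) only [gg, gB1, gB2, ↓reduceIte, if_pos, if_neg, true_and] <;> omega

lemma covV_B1 (h r : ℤ) (hh : 5 ≤ h) (h0 : 0 ≤ r) (h1 : r ≤ 4 * h) :
    CovV h true 1 r := by
  rcases (by omega : (0 ≤ r ∧ r ≤ 2 * h - 2) ∨
      r = 2 * h - 1 ∨
      (2 * h ≤ r ∧ r ≤ 3 * h - 1) ∨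
      r = 3 * h ∨
      r = 3 * h + 1 ∨
      (3 * h + 2 ≤ r ∧ r ≤ 4 * h)) with
    hr | hr | hr | hr | hr | hr <;> [
    refine ⟨false, 2 * h + 4 + 2 * (2 * h - 2 - (r)), 0, ?_⟩;
    refine ⟨false, 2 * h + 2, 0, ?_⟩;
    refine ⟨true, 2 + 2 * (3 * h - 1 - (r)), 0, ?_⟩;
    refine ⟨true, 0, 0, ?_⟩;
    refine ⟨true, 1, 0, ?_⟩;
    refine ⟨true, 3 + 2 * (r - (3 * h + 2)), 0, ?_⟩]
  all_goals refine ⟨by omega, ?_⟩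
  all_goals simp (disch := omega) only [gg, gB1, gB2, ↓reduceIte, if_pos, if_neg, true_and] <;> omega

lemma covV_B2 (h r : ℤ) (hh : 5 ≤ h) (h0 : 0 ≤ r) (h1 : r ≤ 4 * h) :
    CovV h true 2 r := by
  rcases (by omega : (0 ≤ r ∧ r ≤ 2 * h - 2) ∨
      r = 2 * h - 1 ∨
      (2 * h ≤ r ∧ r ≤ 3 * h - 1) ∨
      r = 3 * h ∨
      r = 3 * h + 1 ∨
      (3 * h + 2 ≤ r ∧ r ≤ 4 * h)) with
    hr | hr | hr | hr | hr | hr <;> [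
    refine ⟨false, 2 * h + 3 + 2 * (r - (0)), 0, ?_⟩;
    refine ⟨false, 6 * h + 1, 0, ?_⟩;
    refine ⟨false, 6 * h + 2 + 2 * (r - (2 * h)), 0, ?_⟩;
    refine ⟨false, 1, 0, ?_⟩;
    refine ⟨false, 8 * h + 1, 0, ?_⟩;
    refine ⟨false, 6 * h + 3 + 2 * (-1 - (r + (-1) * (4 * h + 1))), -1, ?_⟩]
  all_goals refine ⟨by omega, ?_⟩
  all_goals simp (disch := omega) only [gg, gB1, ↓reduceIte, if_pos, if_neg, true_and] <;> omega

lemma covV_B3 (h r : ℤ) (hh : 5 ≤ h) (h0 : 0 ≤ r) (h1 : r ≤ 4 * h) (hm : r ≠ 2 * h) :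
    CovV h true 3 r := by
  rcases (by omega : (0 ≤ r ∧ r ≤ h - 1) ∨
      (h ≤ r ∧ r ≤ 2 * h - 1) ∨
      (2 * h + 1 ≤ r ∧ r ≤ 3 * h - 1) ∨
      r = 3 * h ∨
      (3 * h + 1 ≤ r ∧ r ≤ 4 * h)) with
    hr | hr | hr | hr | hr <;> [
    refine ⟨true, 4 * h + 2 + 2 * (r + (1) * (4 * h + 1) - (3 * h + 1)), 1, ?_⟩;
    refine ⟨true, 2 * h + 2 + 2 * (2 * h - 1 - (r)), 0, ?_⟩;
    refine ⟨true, 2 * h + 3 + 2 * (r - (2 * h + 1)), 0, ?_⟩;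
    refine ⟨true, 4 * h + 1, 0, ?_⟩;
    refine ⟨true, 4 * h + 2 + 2 * (r - (3 * h + 1)), 0, ?_⟩]
  all_goals refine ⟨by omega, ?_⟩
  all_goals simp (disch := omega) only [gg, gB2, ↓reduceIte, if_pos, if_neg, true_and] <;> omega

lemma covE_00 (h d : ℤ) (hh : 5 ≤ h) (h0 : 1 ≤ d) (h1 : d ≤ 2 * h) :
    CovE h 0 0 d := by
  rcases (by omega : (1 ≤ d ∧ d ≤ 2 * h - 2 ∧ d % 2 = 0) ∨
      (1 ≤ d ∧ d ≤ 2 * h - 2 ∧ d % 2 = 1) ∨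
      d = 2 * h - 1 ∨
      d = 2 * h) with
    hr | hr | hr | hr <;> [
    refine ⟨true, false, 3 + (-(d + (-1) * (4 * h + 1)) - (2 * h + 3)), 3 + (-(d + (-1) * (4 * h + 1)) - (2 * h + 3)) + 1, -1, by omega, Or.inr ?_⟩;
    refine ⟨true, false, 3 + (-(d + (-1) * (4 * h + 1)) - (2 * h + 3)), 3 + (-(d + (-1) * (4 * h + 1)) - (2 * h + 3)) + 1, -1, by omega, Or.inl ?_⟩;
    refine ⟨true, false, 2, 3, -1, by omega, Or.inl ?_⟩;
    refine ⟨false, false, 0, 1, 0, by omega, Or.inl ?_⟩]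
  all_goals simp (disch := omega) only [gg, gA1, gB1, ↓reduceIte, if_pos, if_neg, true_and] <;> omega

lemma covE_01 (h d : ℤ) (hh : 5 ≤ h) (h0 : 0 ≤ d) (h1 : d ≤ 4 * h) :
    CovE h 0 1 d := by
  rcases (by omega : (0 ≤ d ∧ d ≤ 2 * h - 4 ∧ d % 2 = 0) ∨
      (0 ≤ d ∧ d ≤ 2 * h - 4 ∧ d % 2 = 1) ∨
      d = 2 * h - 3 ∨
      d = 2 * h - 2 ∨
      d = 2 * h - 1 ∨
      d = 2 * h ∨
      (2 * h + 1 ≤ d ∧ d ≤ 4 * h ∧ d % 2 = 0) ∨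
      (2 * h + 1 ≤ d ∧ d ≤ 4 * h ∧ d % 2 = 1)) with
    hr | hr | hr | hr | hr | hr | hr | hr <;> [
    refine ⟨false, true, 4 * h + 4 + (d - (-2 * h)), 4 * h + 4 + (d - (-2 * h)) + 1, 0, by omega, Or.inl ?_⟩;
    refine ⟨false, true, 4 * h + 4 + (d - (-2 * h)), 4 * h + 4 + (d - (-2 * h)) + 1, 0, by omega, Or.inr ?_⟩;
    refine ⟨false, false, 4 * h, 4 * h + 1, 0, by omega, Or.inl ?_⟩;
    refine ⟨false, true, 8 * h + 1, 0, 0, by omega, Or.inr ?_⟩;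
    refine ⟨true, false, 2 * h + 1, 2 * h + 2, 0, by omega, Or.inl ?_⟩;
    refine ⟨true, true, 8 * h + 1, 0, 0, by omega, Or.inl ?_⟩;
    refine ⟨false, true, 4 * h + 4 + (d + (-1) * (4 * h + 1) - (-2 * h)), 4 * h + 4 + (d + (-1) * (4 * h + 1) - (-2 * h)) + 1, -1, by omega, Or.inr ?_⟩;
    refine ⟨false, true, 4 * h + 4 + (d + (-1) * (4 * h + 1) - (-2 * h)), 4 * h + 4 + (d + (-1) * (4 * h + 1) - (-2 * h)) + 1, -1, by omega, Or.inl ?_⟩]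
  all_goals simp (disch := omega) only [gg, gA1, gA2, gB1, gB2, ↓reduceIte, if_pos, if_neg, true_and] <;> omega

lemma covE_02 (h d : ℤ) (hh : 5 ≤ h) (h0 : 0 ≤ d) (h1 : d ≤ 4 * h) :
    CovE h 0 2 d := by
  rcases (by omega : d = 0 ∨
      d = 1 ∨
      d = 2 ∨
      d = 3 ∨
      (4 ≤ d ∧ d ≤ 4 * h - 2 ∧ d % 2 = 0) ∨
      (4 ≤ d ∧ d ≤ 4 * h - 2 ∧ d % 2 = 1) ∨
      d = 4 * h - 1 ∨
      d = 4 * h) with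
    hr | hr | hr | hr | hr | hr | hr | hr <;> [
    refine ⟨true, false, 0, 1, 0, by omega, Or.inl ?_⟩;
    refine ⟨true, false, 8 * h + 1, 0, 0, by omega, Or.inr ?_⟩;
    refine ⟨false, false, 3, 4, 0, by omega, Or.inr ?_⟩;
    refine ⟨false, false, 4, 5, 0, by omega, Or.inl ?_⟩;
    refine ⟨false, false, 5 + (-4 - (-(d))), 5 + (-4 - (-(d))) + 1, 0, by omega, Or.inr ?_⟩;
    refine ⟨false, false, 5 + (-4 - (-(d))), 5 + (-4 - (-(d))) + 1, 0, by omega, Or.inl ?_⟩;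
    refine ⟨false, false, 8 * h + 1, 0, -1, by omega, Or.inr ?_⟩;
    refine ⟨true, false, 1, 2, -1, by omega, Or.inr ?_⟩]
  all_goals simp (disch := omega) only [gg, gA1, gB1, ↓reduceIte, if_pos, if_neg, true_and] <;> omega

lemma covE_03 (h d : ℤ) (hh : 5 ≤ h) (h0 : 0 ≤ d) (h1 : d ≤ 4 * h) :
    CovE h 0 3 d := by
  rcases (by omega : d = 0 ∨
      d = 1 ∨
      (2 ≤ d ∧ d ≤ 4 * h ∧ d % 2 = 0) ∨
      (2 ≤ d ∧ d ≤ 4 * h ∧ d % 2 = 1)) with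
    hr | hr | hr | hr <;> [
    refine ⟨false, true, 0, 1, 0, by omega, Or.inl ?_⟩;
    refine ⟨false, true, 4 * h + 3, 4 * h + 4, 0, by omega, Or.inr ?_⟩;
    refine ⟨true, true, 4 * h + 2 + (-2 - (-(d))), 4 * h + 2 + (-2 - (-(d))) + 1, 0, by omega, Or.inr ?_⟩;
    refine ⟨true, true, 4 * h + 2 + (-2 - (-(d))), 4 * h + 2 + (-2 - (-(d))) + 1, 0, by omega, Or.inl ?_⟩]
  all_goals simp (disch := omega) only [gg, gA2, gB2, ↓reduceIte, if_pos, if_neg, true_and] <;> omega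

lemma covE_11 (h d : ℤ) (hh : 5 ≤ h) (h0 : 1 ≤ d) (h1 : d ≤ 2 * h) :
    CovE h 1 1 d := by
  rcases (by omega : d = 1 ∨
      d = 2 ∨
      (3 ≤ d ∧ d ≤ 2 * h ∧ d % 2 = 0) ∨
      (3 ≤ d ∧ d ≤ 2 * h ∧ d % 2 = 1)) with
    hr | hr | hr | hr <;> [
    refine ⟨true, true, 0, 1, 0, by omega, Or.inl ?_⟩;
    refine ⟨true, true, 1, 2, 0, by omega, Or.inr ?_⟩;
    refine ⟨true, true, 2 + (d - (3)), 2 + (d - (3)) + 1, 0, by omega, Or.inr ?_⟩;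
    refine ⟨true, true, 2 + (d - (3)), 2 + (d - (3)) + 1, 0, by omega, Or.inl ?_⟩]
  all_goals simp (disch := omega) only [gg, gB2, ↓reduceIte, if_pos, if_neg, true_and] <;> omega

lemma covE_12 (h d : ℤ) (hh : 5 ≤ h) (h0 : 0 ≤ d) (h1 : d ≤ 4 * h) :
    CovE h 1 2 d := by
  rcases (by omega : (0 ≤ d ∧ d ≤ 2 * h - 2 ∧ d % 2 = 0) ∨
      (0 ≤ d ∧ d ≤ 2 * h - 2 ∧ d % 2 = 1) ∨
      d = 2 * h - 1 ∨
      d = 2 * h ∨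
      d = 2 * h + 1 ∨
      d = 2 * h + 2 ∨
      (2 * h + 3 ≤ d ∧ d ≤ 4 * h ∧ d % 2 = 0) ∨
      (2 * h + 3 ≤ d ∧ d ≤ 4 * h ∧ d % 2 = 1)) with
    hr | hr | hr | hr | hr | hr | hr | hr <;> [
    refine ⟨true, false, 2 * h + 3 + (2 * h - 2 - (-(d))), 2 * h + 3 + (2 * h - 2 - (-(d))) + 1, 0, by omega, Or.inr ?_⟩;
    refine ⟨true, false, 2 * h + 3 + (2 * h - 2 - (-(d))), 2 * h + 3 + (2 * h - 2 - (-(d))) + 1, 0, by omega, Or.inl ?_⟩;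
    refine ⟨true, false, 6 * h, 6 * h + 1, 0, by omega, Or.inl ?_⟩;
    refine ⟨false, true, 4 * h + 1, 4 * h + 2, 0, by omega, Or.inr ?_⟩;
    refine ⟨false, true, 2, 3, 0, by omega, Or.inl ?_⟩;
    refine ⟨true, false, 2 * h + 2, 2 * h + 3, -1, by omega, Or.inl ?_⟩;
    refine ⟨true, false, 2 * h + 3 + (2 * h - 2 - (-(d + (-1) * (4 * h + 1)))), 2 * h + 3 + (2 * h - 2 - (-(d + (-1) * (4 * h + 1)))) + 1, -1, by omega, Or.inl ?_⟩;
    refine ⟨true, false, 2 * h + 3 + (2 * h - 2 - (-(d + (-1) * (4 * h + 1)))), 2 * h + 3 + (2 * h - 2 - (-(d + (-1) * (4 * h + 1)))) + 1, -1, by omega, Or.inr ?_⟩]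
  all_goals simp (disch := omega) only [gg, gA2, gB1, ↓reduceIte, if_pos, if_neg, true_and] <;> omega

lemma covE_13 (h d : ℤ) (hh : 5 ≤ h) (h0 : 0 ≤ d) (h1 : d ≤ 4 * h) :
    CovE h 1 3 d := by
  rcases (by omega : (d = 0 ∧ d % 2 = 0) ∨
      (d = 0 ∧ d % 2 = 1) ∨
      d = 1 ∨
      d = 2 ∨
      (3 ≤ d ∧ d ≤ 4 * h ∧ d % 2 = 0) ∨
      (3 ≤ d ∧ d ≤ 4 * h ∧ d % 2 = 1)) with
    hr | hr | hr | hr | hr | hr <;> [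
    refine ⟨false, false, 4 * h + 1 + (d + (1) * (4 * h + 1) - (3)), 4 * h + 1 + (d + (1) * (4 * h + 1) - (3)) + 1, 1, by omega, Or.inl ?_⟩;
    refine ⟨false, false, 4 * h + 1 + (d + (1) * (4 * h + 1) - (3)), 4 * h + 1 + (d + (1) * (4 * h + 1) - (3)) + 1, 1, by omega, Or.inr ?_⟩;
    refine ⟨false, true, 1, 2, 0, by omega, Or.inr ?_⟩;
    refine ⟨false, true, 4 * h + 2, 4 * h + 3, 0, by omega, Or.inl ?_⟩;
    refine ⟨false, false, 4 * h + 1 + (d - (3)), 4 * h + 1 + (d - (3)) + 1, 0, by omega, Or.inr ?_⟩;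
    refine ⟨false, false, 4 * h + 1 + (d - (3)), 4 * h + 1 + (d - (3)) + 1, 0, by omega, Or.inl ?_⟩]
  all_goals simp (disch := omega) only [gg, gA1, gA2, ↓reduceIte, if_pos, if_neg, true_and] <;> omega

lemma covE_22 (h d : ℤ) (hh : 5 ≤ h) (h0 : 1 ≤ d) (h1 : d ≤ 2 * h) :
    CovE h 2 2 d := by
  rcases (by omega : d = 1 ∨
      d = 2 ∨
      (3 ≤ d ∧ d ≤ 2 * h ∧ d % 2 = 0) ∨
      (3 ≤ d ∧ d ≤ 2 * h ∧ d % 2 = 1)) with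
    hr | hr | hr | hr <;> [
    refine ⟨true, false, 6 * h + 1, 6 * h + 2, 0, by omega, Or.inl ?_⟩;
    refine ⟨true, false, 8 * h, 8 * h + 1, 0, by omega, Or.inl ?_⟩;
    refine ⟨true, false, 6 * h + 2 + (-2 * h - 1 - (d + (-1) * (4 * h + 1))), 6 * h + 2 + (-2 * h - 1 - (d + (-1) * (4 * h + 1))) + 1, -1, by omega, Or.inl ?_⟩;
    refine ⟨true, false, 6 * h + 2 + (-2 * h - 1 - (d + (-1) * (4 * h + 1))), 6 * h + 2 + (-2 * h - 1 - (d + (-1) * (4 * h + 1))) + 1, -1, by omega, Or.inr ?_⟩]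
  all_goals simp (disch := omega) only [gg, gB1, ↓reduceIte, if_pos, if_neg, true_and] <;> omega

lemma covE_23 (h d : ℤ) (hh : 5 ≤ h) (h0 : 0 ≤ d) (h1 : d ≤ 4 * h) (hm : d ≠ 2 * h + 2) (hm2 : d ≠ 2 * h + 3) :
    CovE h 2 3 d := by
  rcases (by omega : (0 ≤ d ∧ d ≤ 2 * h - 1 ∧ d % 2 = 0) ∨
      (0 ≤ d ∧ d ≤ 2 * h - 1 ∧ d % 2 = 1) ∨
      d = 2 * h ∨
      d = 2 * h + 1 ∨
      (2 * h + 4 ≤ d ∧ d ≤ 4 * h ∧ d % 2 = 0) ∨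
      (2 * h + 4 ≤ d ∧ d ≤ 4 * h ∧ d % 2 = 1)) with
    hr | hr | hr | hr | hr | hr <;> [
    refine ⟨false, true, 4 + (-(d + (-1) * (4 * h + 1)) - (2 * h + 2)), 4 + (-(d + (-1) * (4 * h + 1)) - (2 * h + 2)) + 1, -1, by omega, Or.inl ?_⟩;
    refine ⟨false, true, 4 + (-(d + (-1) * (4 * h + 1)) - (2 * h + 2)), 4 + (-(d + (-1) * (4 * h + 1)) - (2 * h + 2)) + 1, -1, by omega, Or.inr ?_⟩;
    refine ⟨false, true, 3, 4, -1, by omega, Or.inl ?_⟩;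
    refine ⟨false, false, 8 * h, 8 * h + 1, 0, by omega, Or.inr ?_⟩;
    refine ⟨false, true, 4 + (-(d + (-2) * (4 * h + 1)) - (2 * h + 2)), 4 + (-(d + (-2) * (4 * h + 1)) - (2 * h + 2)) + 1, -2, by omega, Or.inr ?_⟩;
    refine ⟨false, true, 4 + (-(d + (-2) * (4 * h + 1)) - (2 * h + 2)), 4 + (-(d + (-2) * (4 * h + 1)) - (2 * h + 2)) + 1, -2, by omega, Or.inl ?_⟩]
  all_goals simp (disch := omega) only [gg, gA1, gA2, ↓reduceIte, if_pos, if_neg, true_and] <;> omega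

lemma covE_33 (h d : ℤ) (hh : 5 ≤ h) (h0 : 1 ≤ d) (h1 : d ≤ 2 * h) :
    CovE h 3 3 d := by
  rcases (by omega : d = 1 ∨
      (2 ≤ d ∧ d ≤ 2 * h - 1 ∧ d % 2 = 0) ∨
      (2 ≤ d ∧ d ≤ 2 * h - 1 ∧ d % 2 = 1) ∨
      d = 2 * h) with
    hr | hr | hr | hr <;> [
    refine ⟨true, true, 4 * h + 1, 4 * h + 2, 0, by omega, Or.inl ?_⟩;
    refine ⟨true, true, 2 * h + 2 + (d - (2)), 2 * h + 2 + (d - (2)) + 1, 0, by omega, Or.inl ?_⟩;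
    refine ⟨true, true, 2 * h + 2 + (d - (2)), 2 * h + 2 + (d - (2)) + 1, 0, by omega, Or.inr ?_⟩;
    refine ⟨true, true, 4 * h, 4 * h + 1, 0, by omega, Or.inl ?_⟩]
  all_goals simp (disch := omega) only [gg, gB2, ↓reduceIte, if_pos, if_neg, true_and] <;> omega

lemma covI_0 (h : ℤ) (hh : 5 ≤ h) : CovI h 0 := by
  refine ⟨false, false, 1, 2, by omega, Or.inl ?_⟩
  simp (disch := omega) only [gg, gA1, ↓reduceIte, if_pos, if_neg, and_self]

lemma covI_1 (h : ℤ) (hh : 5 ≤ h) : CovI h 1 := by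
  refine ⟨true, true, 2 * h, 2 * h + 1, by omega, Or.inl ?_⟩
  simp (disch := omega) only [gg, gB2, ↓reduceIte, if_pos, if_neg, and_self]

lemma covI_2 (h : ℤ) (hh : 5 ≤ h) : CovI h 2 := by
  refine ⟨false, false, 2, 3, by omega, Or.inr ?_⟩
  simp (disch := omega) only [gg, gA1, ↓reduceIte, if_pos, if_neg, and_self]

lemma covI_3 (h : ℤ) (hh : 5 ≤ h) : CovI h 3 := by
  refine ⟨true, true, 2 * h + 1, 2 * h + 2, by omega, Or.inr ?_⟩
  simp (disch := omega) only [gg, gB2, ↓reduceIte, if_pos, if_neg, and_self]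

lemma covV_A4 (h : ℤ) (hh : 5 ≤ h) : ∃ j p, 0 ≤ p ∧ p ≤ 8 * h + 1 ∧ (gg h false j p).1 = 4 := by
  refine ⟨false, 2, by omega, by omega, ?_⟩
  simp (disch := omega) only [gg, gA1, ↓reduceIte, if_pos, if_neg, and_self]

lemma covV_B4 (h : ℤ) (hh : 5 ≤ h) : ∃ j p, 0 ≤ p ∧ p ≤ 8 * h + 1 ∧ (gg h true j p).1 = 4 := by
  refine ⟨true, 2 * h + 1, by omega, by omega, ?_⟩
  simp (disch := omega) only [gg, gB2, ↓reduceIte, if_pos, if_neg, and_self]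

/-! ### Counting: coverage of all vertices and of all edges suffices -/

/-- If the classes cover all vertices but one and every pair is an edge of some cycle,
then counting gives all disjointness and uniqueness conditions. -/
lemma arcs_of_cover {I J K V : Type} [Fintype I] [Fintype J] [Fintype K] [Fintype V]
    (k : ℕ) [NeZero k] (hI : Fintype.card I = k) (hJ : Fintype.card J = 2)
    (hK : Fintype.card K = 1) (hV : Fintype.card V = 2 * k + 1)
    (a : I → J → ZMod k → V) (c : K → ZMod k → V) (miss : I → V)
    (hc : ∀ j, Function.Injective (c j))
    (h1 : ∀ i v, v ≠ miss i → ∃ j x, a i j x = v)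
    (h2 : ∀ u v, u ≠ v → (∃ i j x, s(u, v) = s(a i j x, a i j (x + 1))) ∨
      ∃ j x, s(u, v) = s(c j x, c j (x + 1))) :
    (∀ i j, Function.Injective (a i j)) ∧
    (∀ j, Function.Injective (c j)) ∧
    (∀ i, ∀ j₁ j₂, j₁ ≠ j₂ → Disjoint (Set.range (a i j₁)) (Set.range (a i j₂))) ∧
    (∀ j₁ j₂, j₁ ≠ j₂ → Disjoint (Set.range (c j₁)) (Set.range (c j₂))) ∧
    (∀ e : Sym2 V, ¬ e.IsDiag →
      ∃! p : (I × J) ⊕ K,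
        e ∈ Sum.elim (fun q => cycleEdgeSet (a q.1 q.2)) (fun j => cycleEdgeSet (c j)) p) := by
  classical
  have key : ∀ i, Function.Injective (fun y : J × ZMod k => a i y.1 y.2) := by
    intro i
    let F : Option (J × ZMod k) → V := fun o => o.elim (miss i) (fun y => a i y.1 y.2)
    have hF : Function.Bijective F := by
      rw [Fintype.bijective_iff_surjective_and_card]
      constructor
      · intro v
        by_cases hv : v = miss i
        · exact ⟨none, hv.symm⟩
        · obtain ⟨j, x, hx⟩ := h1 i v hv
          exact ⟨some (j, x), hx⟩
      · simp [hJ, hV, ZMod.card]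
    intro y z hyz
    exact Option.some_injective _ (hF.1 (show F (some y) = F (some z) from hyz))
  let cyc : (I × J) ⊕ K → ZMod k → V := Sum.elim (fun q => a q.1 q.2) c
  let G : ((I × J) ⊕ K) × ZMod k → Sym2 V := fun y => s(cyc y.1 y.2, cyc y.1 (y.2 + 1))
  have hsub : (Finset.univ.filter (fun e : Sym2 V => ¬ e.IsDiag)) ⊆ Finset.univ.image G := by
    intro e
    induction e with | _ u v =>
    intro he
    have huv : u ≠ v := by simpa using he
    rw [Finset.mem_image]
    rcases h2 u v huv with ⟨i, j, x, hx⟩ | ⟨j, x, hx⟩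
    · exact ⟨(Sum.inl (i, j), x), Finset.mem_univ _, hx.symm⟩
    · exact ⟨(Sum.inr j, x), Finset.mem_univ _, hx.symm⟩
  have hcard : (Finset.univ.filter (fun e : Sym2 V => ¬ e.IsDiag)).card = (2 * k + 1) * k := by
    rw [← Fintype.card_subtype, Sym2.card_subtype_not_diag, hV, Nat.choose_two_right]
    have : (2 * k + 1) * (2 * k + 1 - 1) = ((2 * k + 1) * k) * 2 := by
      rw [Nat.add_sub_cancel]; ring
    rw [this, Nat.mul_div_cancel _ (by norm_num)]
  have hdom : Fintype.card (((I × J) ⊕ K) × ZMod k) = (2 * k + 1) * k := by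
    simp only [Fintype.card_prod, Fintype.card_sum, hI, hJ, hK, ZMod.card]
    ring
  have hG : Function.Injective G := by
    have hle := Finset.card_le_card hsub
    have hle2 : (Finset.univ.image G).card ≤ _ := Finset.card_image_le
    rw [Finset.card_univ] at hle2
    have : (Finset.univ.image G).card = (Finset.univ : Finset (((I × J) ⊕ K) × ZMod k)).card := by
      rw [Finset.card_univ]; omega
    rw [Finset.card_image_iff] at this
    exact fun y z hyz => this (by simp) (by simp) hyz
  have hmem : ∀ e p, e ∈ Sum.elim (fun q : I × J => cycleEdgeSet (a q.1 q.2))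
      (fun j => cycleEdgeSet (c j)) p ↔ ∃ x, e = G (p, x) := by
    rintro e (q | j) <;> rfl
  refine ⟨?_, hc, ?_, ?_, ?_⟩
  · intro i j x y hxy
    have := key i (a₁ := (j, x)) (a₂ := (j, y)) hxy
    simpa using this
  · intro i j₁ j₂ hj
    rw [Set.disjoint_left]
    rintro v ⟨x, rfl⟩ ⟨y, hy⟩
    have := key i (a₁ := (j₂, y)) (a₂ := (j₁, x)) hy
    exact hj (congrArg Prod.fst this).symm
  · intro j₁ j₂ hj
    have := Fintype.card_le_one_iff_subsingleton.1 hK.le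
    exact absurd (Subsingleton.elim _ _) hj
  · intro e he
    have : e ∈ Finset.univ.image G := hsub (by simpa using he)
    obtain ⟨⟨p, x⟩, -, hx⟩ := Finset.mem_image.1 this
    refine ⟨p, (hmem e p).2 ⟨x, hx.symm⟩, ?_⟩
    intro p' hp'
    obtain ⟨x', hx'⟩ := (hmem e p').1 hp'
    have := hG (hx.trans hx')
    exact (congrArg Prod.fst this).symm

/-! ### Developing the base cycles -/

/-- Decode a pair (layer, position) to a vertex, translated by `t`; layer `4` gives infinity. -/
def dec {n : ℕ} (t : ZMod n) (w : ℕ × ℤ) : Option (Fin 4 × ZMod n) :=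
  if hl : w.1 < 4 then some (⟨w.1, hl⟩, (w.2 : ZMod n) + t) else none

lemma dec_some {n : ℕ} (t : ZMod n) (w : ℕ × ℤ) (l : Fin 4) (y : ZMod n) (hw : w.1 = l)
    (hy : (w.2 : ZMod n) + t = y) : dec t w = some (l, y) := by
  have hl : w.1 < 4 := hw ▸ l.2
  subst hy
  simp [dec, hw]

lemma dec_none {n : ℕ} (t : ZMod n) (w : ℕ × ℤ) (hw : w.1 = 4) : dec t w = none := by
  simp [dec, hw]

lemma exists_idx (h : ℕ) (p : ℤ) (hp : 0 ≤ p ∧ p ≤ 8 * h + 1) :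
    ∃ x : ZMod (8 * h + 2), (x.val : ℤ) = p := by
  refine ⟨(p.toNat : ZMod (8 * h + 2)), ?_⟩
  rw [ZMod.val_natCast, Nat.mod_eq_of_lt (by omega)]
  omega

lemma val_succ (h : ℕ) (x : ZMod (8 * h + 2)) :
    (x + 1).val = if x.val = 8 * h + 1 then 0 else x.val + 1 := by
  have : Fact (1 < 8 * h + 2) := ⟨by omega⟩
  have hx := ZMod.val_lt x
  rw [ZMod.val_add, ZMod.val_one]
  split_ifs with hc
  · rw [hc]; exact Nat.mod_self _
  · exact Nat.mod_eq_of_lt (by omega)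

lemma exists_next (h : ℕ) (p p' : ℤ) (hp : NextIdx h p p') :
    ∃ x : ZMod (8 * h + 2), (x.val : ℤ) = p ∧ ((x + 1).val : ℤ) = p' := by
  obtain ⟨x, hx⟩ := exists_idx h p hp.1
  refine ⟨x, hx, ?_⟩
  have := hp.2
  rw [val_succ]
  split_ifs <;> push_cast <;> omega

/-- The developed cycles. -/
def bigCycle (h : ℕ) (i : ZMod (4 * h + 1) × Bool) (j : Bool) (x : ZMod (8 * h + 2)) :
    Option (Fin 4 × ZMod (4 * h + 1)) :=
  dec i.1 (gg h i.2 j x.val)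

/-- The cycle of the half-parallel class. -/
def halfCycle (h : ℕ) (x : ZMod (8 * h + 2)) : Option (Fin 4 × ZMod (4 * h + 1)) :=
  if x.val % 2 = 0 then some (2, ((x.val / 2 : ℕ) : ZMod (4 * h + 1)))
  else some (3, ((x.val / 2 + 2 * h + 3 : ℕ) : ZMod (4 * h + 1)))

/-- The vertex missed by a class. -/
def missed (h : ℕ) (i : ZMod (4 * h + 1) × Bool) : Option (Fin 4 × ZMod (4 * h + 1)) :=
  dec i.1 (if i.2 then (3, 2 * (h : ℤ)) else (2, 4 * (h : ℤ)))

lemma zmod_cast_n (h : ℕ) : (4 * (h : ZMod (4 * h + 1)) + 1) = 0 := by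
  have := ZMod.natCast_self (4 * h + 1)
  push_cast at this
  exact this

lemma halfCycle_injective (h : ℕ) : Function.Injective (halfCycle h) := by
  intro x y hxy
  have hx := ZMod.val_lt x
  have hy := ZMod.val_lt y
  apply ZMod.val_injective
  unfold halfCycle at hxy
  split_ifs at hxy with h1 h2 h2
  · simp only [Option.some.injEq, Prod.mk.injEq, true_and] at hxy
    rw [ZMod.natCast_eq_natCast_iff', Nat.mod_eq_of_lt (by omega), Nat.mod_eq_of_lt (by omega)]
      at hxy
    omega
  · simp at hxy
  · simp at hxy
  · simp only [Option.some.injEq, Prod.mk.injEq, true_and] at hxy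
    push_cast at hxy
    rw [add_left_inj, add_left_inj] at hxy
    rw [ZMod.natCast_eq_natCast_iff', Nat.mod_eq_of_lt (by omega), Nat.mod_eq_of_lt (by omega)]
      at hxy
    omega

lemma bigCycle_cover (h : ℕ) (hh : 5 ≤ h) (i : ZMod (4 * h + 1) × Bool)
    (v : Option (Fin 4 × ZMod (4 * h + 1))) (hv : v ≠ missed h i) :
    ∃ j x, bigCycle h i j x = v := by
  have hh' : (5 : ℤ) ≤ h := by exact_mod_cast hh
  obtain ⟨t, X⟩ := i
  rcases v with _ | ⟨l, y⟩
  · have : ∃ j p, 0 ≤ p ∧ p ≤ 8 * (h : ℤ) + 1 ∧ (gg h X j p).1 = 4 := by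
      cases X
      · exact covV_A4 h hh'
      · exact covV_B4 h hh'
    obtain ⟨j, p, h0, h1, hp⟩ := this
    obtain ⟨x, hx⟩ := exists_idx h p ⟨h0, h1⟩
    exact ⟨j, x, dec_none _ _ (by rw [hx]; exact hp)⟩
  · have hlt := ZMod.val_lt (y - t)
    have hcast : (((y - t).val : ℤ) : ZMod (4 * h + 1)) = y - t := by
      rw [Int.cast_natCast, ZMod.natCast_val, ZMod.cast_id]
    have hr0 : (0 : ℤ) ≤ ((y - t).val : ℤ) := by positivity
    have hr1 : ((y - t).val : ℤ) ≤ 4 * h := by omega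
    have hm : ∀ w : ℕ × ℤ, missed h (t, X) = dec t w → w.1 = l → ((y - t).val : ℤ) ≠ w.2 := by
      intro w hw hl hval
      apply hv
      rw [hw]
      refine (dec_some t w l y hl ?_).symm
      rw [← hval, hcast]
      ring
    have : CovV h X l ((y - t).val : ℤ) := by
      generalize hr : ((y - t).val : ℤ) = r at *
      cases X
      · fin_cases l
        · exact covV_A0 h r hh' hr0 hr1
        · exact covV_A1 h r hh' hr0 hr1
        · exact covV_A2 h r hh' hr0 hr1 (hm (2, 4 * (h : ℤ)) rfl rfl)
        · exact covV_A3 h r hh' hr0 hr1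
      · fin_cases l
        · exact covV_B0 h r hh' hr0 hr1
        · exact covV_B1 h r hh' hr0 hr1
        · exact covV_B2 h r hh' hr0 hr1
        · exact covV_B3 h r hh' hr0 hr1 (hm (3, 2 * (h : ℤ)) rfl rfl)
    obtain ⟨j, p, q, hp, hl, hpos⟩ := this
    obtain ⟨x, hx⟩ := exists_idx h p hp
    refine ⟨j, x, dec_some _ _ l y ?_ ?_⟩
    · rw [hx]; exact hl
    · rw [hx]
      dsimp only
      rw [hpos, Int.cast_add, hcast]
      push_cast
      rw [zmod_cast_n]
      ring

/-- An edge whose difference occurs on a base cycle lies on a developed cycle. -/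
lemma edge_of_covE (h : ℕ) (l l' : Fin 4) (y y' : ZMod (4 * h + 1)) (d : ℤ)
    (hd : (d : ZMod (4 * h + 1)) = y' - y) (hc : CovE h l l' d) :
    ∃ i j x, s(some (l, y), some (l', y')) = s(bigCycle h i j x, bigCycle h i j (x + 1)) := by
  obtain ⟨X, j, p, p', q, hp, hc⟩ := hc
  obtain ⟨x, hx, hx'⟩ := exists_next h p p' hp
  have hn := zmod_cast_n h
  rcases hc with ⟨h1, h2, h3⟩ | ⟨h1, h2, h3⟩
  · refine ⟨(y - ((gg h X j p).2 : ZMod (4 * h + 1)), X), j, x, ?_⟩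
    have e1 : bigCycle h (y - ((gg h X j p).2 : ZMod (4 * h + 1)), X) j x = some (l, y) :=
      dec_some _ _ l y (by rw [hx]; exact h1) (by rw [hx]; ring)
    have e2 : bigCycle h (y - ((gg h X j p).2 : ZMod (4 * h + 1)), X) j (x + 1)
        = some (l', y') := by
      refine dec_some _ _ l' y' (by rw [hx']; exact h2) ?_
      rw [hx']
      have := congrArg (Int.cast : ℤ → ZMod (4 * h + 1)) h3
      push_cast at this
      rw [hn, hd] at this
      dsimp only
      linear_combination this
    rw [e1, e2]
  · refine ⟨(y - ((gg h X j p').2 : ZMod (4 * h + 1)), X), j, x, ?_⟩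
    have e1 : bigCycle h (y - ((gg h X j p').2 : ZMod (4 * h + 1)), X) j (x + 1) = some (l, y) :=
      dec_some _ _ l y (by rw [hx']; exact h1) (by rw [hx']; ring)
    have e2 : bigCycle h (y - ((gg h X j p').2 : ZMod (4 * h + 1)), X) j x = some (l', y') := by
      refine dec_some _ _ l' y' (by rw [hx]; exact h2) ?_
      rw [hx]
      have := congrArg (Int.cast : ℤ → ZMod (4 * h + 1)) h3
      push_cast at this
      rw [hn, hd] at this
      dsimp only
      linear_combination this
    rw [e1, e2]
    exact Sym2.eq_swap

/-- The differences `2 * h + 2` and `2 * h + 3` between layers 2 and 3 are used by the half-class. -/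
lemma edge_half (h : ℕ) (y y' : ZMod (4 * h + 1))
    (hd : y' - y = 2 * h + 2 ∨ y' - y = 2 * h + 3) :
    ∃ x, s(some (2, y), some (3, y')) = s(halfCycle h x, halfCycle h (x + 1)) := by
  have hn := zmod_cast_n h
  rcases hd with hd | hd
  · have hr := ZMod.val_lt (y - 1)
    have hcast : (((y - 1).val : ℕ) : ZMod (4 * h + 1)) = y - 1 := by
      rw [ZMod.natCast_val, ZMod.cast_id]
    generalize (y - 1).val = r at hr hcast
    obtain ⟨x, hx, hx'⟩ := exists_next h (2 * r + 1) (if r = 4 * h then 0 else 2 * r + 2)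
      (by split_ifs <;> omega)
    have hxn : x.val = 2 * r + 1 := by omega
    refine ⟨x, ?_⟩
    have e1 : halfCycle h x = some (3, y') := by
      have hy : y' = y - 1 + 2 * h + 3 := by linear_combination hd
      rw [halfCycle, if_neg (by omega), hxn, show (2 * r + 1) / 2 = r by omega, hy, ← hcast]
      push_cast
      rfl
    have e2 : halfCycle h (x + 1) = some (2, y) := by
      have hy : y = (r : ZMod (4 * h + 1)) + 1 := by rw [hcast]; ring
      by_cases hc : r = 4 * h
      · rw [if_pos hc] at hx'
        have hv : (x + 1).val = 0 := by omega
        rw [halfCycle, if_pos (by omega), hv, hy, hc]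
        push_cast
        rw [hn]
      · rw [if_neg hc] at hx'
        have hv : (x + 1).val = 2 * r + 2 := by omega
        rw [halfCycle, if_pos (by omega), hv, hy, show (2 * r + 2) / 2 = r + 1 by omega]
        push_cast
        rfl
    rw [e1, e2]
    exact Sym2.eq_swap
  · have hr := ZMod.val_lt y
    have hcast : ((y.val : ℕ) : ZMod (4 * h + 1)) = y := by
      rw [ZMod.natCast_val, ZMod.cast_id]
    generalize y.val = r at hr hcast
    obtain ⟨x, hx, hx'⟩ := exists_next h (2 * r) (2 * r + 1) (by omega)
    have hxn : x.val = 2 * r := by omega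
    have hxn' : (x + 1).val = 2 * r + 1 := by omega
    refine ⟨x, ?_⟩
    have e1 : halfCycle h x = some (2, y) := by
      rw [halfCycle, if_pos (by omega), hxn, show (2 * r) / 2 = r by omega, hcast]
    have e2 : halfCycle h (x + 1) = some (3, y') := by
      have hy : y' = y + 2 * h + 3 := by linear_combination hd
      rw [halfCycle, if_neg (by omega), hxn', show (2 * r + 1) / 2 = r by omega, hy, ← hcast]
      push_cast
      rfl
    rw [e1, e2]

/-- Being an edge of one of the cycles. -/
def IsEdge (h : ℕ) (u v : Option (Fin 4 × ZMod (4 * h + 1))) : Prop :=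
  (∃ i j x, s(u, v) = s(bigCycle h i j x, bigCycle h i j (x + 1))) ∨
    ∃ x, s(u, v) = s(halfCycle h x, halfCycle h (x + 1))

lemma IsEdge.symm {h : ℕ} {u v : Option (Fin 4 × ZMod (4 * h + 1))} (e : IsEdge h u v) :
    IsEdge h v u := by
  unfold IsEdge at *
  rwa [Sym2.eq_swap]

lemma isEdge_inf (h : ℕ) (hh : 5 ≤ h) (l : Fin 4) (y : ZMod (4 * h + 1)) :
    IsEdge h (some (l, y)) none := by
  have hh' : (5 : ℤ) ≤ h := by exact_mod_cast hh
  have hI : CovI h l := by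
    fin_cases l
    · exact covI_0 h hh'
    · exact covI_1 h hh'
    · exact covI_2 h hh'
    · exact covI_3 h hh'
  obtain ⟨X, j, p, p', hp, hc⟩ := hI
  obtain ⟨x, hx, hx'⟩ := exists_next h p p' hp
  rcases hc with ⟨h1, h2⟩ | ⟨h1, h2⟩
  · refine Or.inl ⟨(y - ((gg h X j p).2 : ZMod (4 * h + 1)), X), j, x, ?_⟩
    rw [bigCycle, bigCycle, hx, hx', dec_some _ (gg h X j p) l y h1 (by ring), dec_none _ _ h2]
  · refine Or.inl ⟨(y - ((gg h X j p').2 : ZMod (4 * h + 1)), X), j, x, ?_⟩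
    rw [bigCycle, bigCycle, hx, hx', dec_some _ (gg h X j p') l y h1 (by ring), dec_none _ _ h2]
    exact Sym2.eq_swap

lemma cast_val_sub (h : ℕ) (y y' : ZMod (4 * h + 1)) :
    (((y' - y).val : ℤ) : ZMod (4 * h + 1)) = y' - y := by
  rw [Int.cast_natCast, ZMod.natCast_val, ZMod.cast_id]

lemma isEdge_lt (h : ℕ) (hh : 5 ≤ h) (l l' : Fin 4) (hl : l < l') (y y' : ZMod (4 * h + 1)) :
    IsEdge h (some (l, y)) (some (l', y')) := by
  have hh' : (5 : ℤ) ≤ h := by exact_mod_cast hh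
  have hlt := ZMod.val_lt (y' - y)
  have hcast := cast_val_sub h y y'
  have h0 : (0 : ℤ) ≤ ((y' - y).val : ℤ) := by positivity
  have h1 : ((y' - y).val : ℤ) ≤ 4 * h := by omega
  generalize ((y' - y).val : ℤ) = d at h0 h1 hcast
  by_cases hs : (l = 2 ∧ l' = 3) ∧ (d = 2 * h + 2 ∨ d = 2 * h + 3)
  · obtain ⟨⟨rfl, rfl⟩, hs⟩ := hs
    refine Or.inr (edge_half h y y' ?_)
    rw [← hcast]
    rcases hs with rfl | rfl
    · left; push_cast; ring
    · right; push_cast; ring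
  · refine Or.inl (edge_of_covE h l l' y y' d hcast ?_)
    fin_cases l <;> fin_cases l' <;> first
      | exact absurd hl (by decide)
      | exact covE_01 h d hh' h0 h1
      | exact covE_02 h d hh' h0 h1
      | exact covE_03 h d hh' h0 h1
      | exact covE_12 h d hh' h0 h1
      | exact covE_13 h d hh' h0 h1
      | exact covE_23 h d hh' h0 h1 (fun e => hs ⟨⟨rfl, rfl⟩, Or.inl e⟩)
          (fun e => hs ⟨⟨rfl, rfl⟩, Or.inr e⟩)

lemma isEdge_pure_le (h : ℕ) (hh : 5 ≤ h) (l : Fin 4) (y y' : ZMod (4 * h + 1)) (d : ℤ)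
    (hd : (d : ZMod (4 * h + 1)) = y' - y) (h0 : 1 ≤ d) (h1 : d ≤ 2 * h) :
    IsEdge h (some (l, y)) (some (l, y')) := by
  have hh' : (5 : ℤ) ≤ h := by exact_mod_cast hh
  refine Or.inl (edge_of_covE h l l y y' d hd ?_)
  fin_cases l
  · exact covE_00 h d hh' h0 h1
  · exact covE_11 h d hh' h0 h1
  · exact covE_22 h d hh' h0 h1
  · exact covE_33 h d hh' h0 h1

lemma isEdge_pure (h : ℕ) (hh : 5 ≤ h) (l : Fin 4) (y y' : ZMod (4 * h + 1)) (hy : y ≠ y') :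
    IsEdge h (some (l, y)) (some (l, y')) := by
  have hlt := ZMod.val_lt (y' - y)
  have hcast := cast_val_sub h y y'
  have hne : (y' - y).val ≠ 0 := by
    rw [Ne, ZMod.val_eq_zero, sub_eq_zero]
    exact fun e => hy e.symm
  generalize (y' - y).val = d at hlt hne hcast
  by_cases hd : d ≤ 2 * h
  · exact isEdge_pure_le h hh l y y' d hcast (by omega) (by omega)
  · refine (isEdge_pure_le h hh l y' y (4 * h + 1 - d) ?_ (by omega) (by omega)).symm
    push_cast at hcast ⊢
    rw [zmod_cast_n, hcast]
    ring

lemma isEdge_all (h : ℕ) (hh : 5 ≤ h) (u v : Option (Fin 4 × ZMod (4 * h + 1))) (huv : u ≠ v) :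
    IsEdge h u v := by
  rcases u with _ | ⟨l, y⟩ <;> rcases v with _ | ⟨l', y'⟩
  · exact absurd rfl huv
  · exact (isEdge_inf h hh l' y').symm
  · exact isEdge_inf h hh l y
  · rcases lt_trichotomy l l' with hl | hl | hl
    · exact isEdge_lt h hh l l' hl y y'
    · subst hl
      exact isEdge_pure h hh l y y' (fun e => huv (by rw [e]))
    · have hedge := isEdge_lt h hh l' l hl y' y
      exact hedge.symm

/-- For every `k ≥ 42` with `k ≡ 18 (mod 24)`, there exists an almost resolvable
`k`-cycle system of order `2k+1`. -/
theorem arcs_mod24_case_18 (k : ℕ) (hk : 42 ≤ k) (hk24 : k % 24 = 18) :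
    HasARCS k (2 * k + 1) := by
  obtain ⟨h, rfl⟩ : ∃ h, k = 8 * h + 2 := ⟨k / 8, by omega⟩
  have hh : 5 ≤ h := by omega
  have c1 : (2 * (8 * h + 2) + 1 - 1) / 2 = 8 * h + 2 := by omega
  have c2 : (2 * (8 * h + 2) + 1 - 1) / (8 * h + 2) = 2 := by
    rw [Nat.add_sub_cancel, Nat.mul_div_cancel _ (by omega)]
  have c3 : (2 * (8 * h + 2) + 1 - 1) / (2 * (8 * h + 2)) = 1 := by
    rw [Nat.add_sub_cancel, Nat.div_self (by omega)]
  unfold HasARCS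
  let eI : Fin ((2 * (8 * h + 2) + 1 - 1) / 2) ≃ ZMod (4 * h + 1) × Bool :=
    Fintype.equivOfCardEq (by
      rw [Fintype.card_fin, c1, Fintype.card_prod, ZMod.card, Fintype.card_bool]; ring)
  let eJ : Fin ((2 * (8 * h + 2) + 1 - 1) / (8 * h + 2)) ≃ Bool :=
    Fintype.equivOfCardEq (by rw [Fintype.card_fin, c2, Fintype.card_bool])
  let eV : Option (Fin 4 × ZMod (4 * h + 1)) ≃ Fin (2 * (8 * h + 2) + 1) :=
    Fintype.equivOfCardEq (by
      rw [Fintype.card_fin, Fintype.card_option, Fintype.card_prod, ZMod.card, Fintype.card_fin]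
      ring)
  refine ⟨fun i j x => eV (bigCycle h (eI i) (eJ j) x), fun _ x => eV (halfCycle h x),
    arcs_of_cover (8 * h + 2) ?_ ?_ ?_ ?_ _ _ (fun i => eV (missed h (eI i))) ?_ ?_ ?_⟩
  · rw [Fintype.card_fin, c1]
  · rw [Fintype.card_fin, c2]
  · rw [Fintype.card_fin, c3]
  · rw [Fintype.card_fin]
  · exact fun _ => eV.injective.comp (halfCycle_injective h)
  · intro i v hv
    obtain ⟨j, x, hx⟩ := bigCycle_cover h hh (eI i) (eV.symm v)
      (fun e => hv (by rw [← e, Equiv.apply_symm_apply]))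
    exact ⟨eJ.symm j, x, by simp [hx]⟩
  · intro u v huv
    have key : ∀ a b, s(eV.symm u, eV.symm v) = s(a, b) → s(u, v) = s(eV a, eV b) := by
      intro a b hab
      have := congrArg (Sym2.map eV) hab
      simpa using this
    rcases isEdge_all h hh (eV.symm u) (eV.symm v) (fun e => huv (eV.symm.injective e)) with
      ⟨i, j, x, hx⟩ | ⟨x, hx⟩
    · left
      refine ⟨eI.symm i, eJ.symm j, x, ?_⟩
      simp only [Equiv.apply_symm_apply]
      exact key _ _ hx
    · right
      exact ⟨⟨0, by omega⟩, x, key _ _ hx⟩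
end
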